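/- arXiv:2110.15205 — 5 statements merged into one kernel-verified Lean document; each statement's English description precedes it below -/
import Mathlib

section
/- There exists a constant K with K ≤ 1.79 (the Grothendieck constant) such that for all positive integers m, n, r and every matrix T ∈ ℝ^{m×n} with rank(T) ≤ r, one has ‖T‖_∞ ≤ ν1(T) ≤ K √r ‖T‖_∞, where ‖T‖_∞ = max_{i,j} |T_{ij}|. -/
open Matrix Real Set

/-- sup-norm of a vector in ℝ^n -/
noncomputable def supNorm {n : ℕ} (x : Fin n → ℝ) : ℝ := ⨆ j, |x j|

/-- largest entry magnitude of a matrix, the operator norm `ℓ1^n → ℓ∞^m` -/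
noncomputable def entrySup {m n : ℕ} (M : Matrix (Fin m) (Fin n) ℝ) : ℝ :=
  ⨆ i, ⨆ j, |M i j|

/-- 1-nuclear (projective tensor) norm of `T : ℓ1^n → ℓ∞^m`:
`ν1(T) = inf {Σ_i ‖x_i‖_∞ ‖y_i‖_∞ : T = Σ_i y_i x_iᵀ}`. -/
noncomputable def nu1Mat {m n : ℕ} (T : Matrix (Fin m) (Fin n) ℝ) : ℝ :=
  sInf {c | ∃ (s : ℕ) (x : Fin s → (Fin n → ℝ)) (y : Fin s → (Fin m → ℝ)),
    (∀ a b, T a b = ∑ i, y i a * x i b) ∧ c = ∑ i, supNorm (x i) * supNorm (y i)}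

open MeasureTheory ProbabilityTheory

theorem abs_le_supNorm {n : ℕ} (x : Fin n → ℝ) (j : Fin n) : |x j| ≤ supNorm x :=
  le_ciSup (f := fun j => |x j|) (finite_range _).bddAbove j

theorem supNorm_nonneg {n : ℕ} (x : Fin n → ℝ) : 0 ≤ supNorm x :=
  Real.iSup_nonneg fun _ => abs_nonneg _

theorem supNorm_le {n : ℕ} {x : Fin n → ℝ} {c : ℝ} (hc : 0 ≤ c) (h : ∀ j, |x j| ≤ c) :
    supNorm x ≤ c :=
  Real.iSup_le h hc

theorem abs_le_entrySup {m n : ℕ} (T : Matrix (Fin m) (Fin n) ℝ) (i : Fin m) (j : Fin n) :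
    |T i j| ≤ entrySup T :=
  (abs_le_supNorm (T i) j).trans
    (le_ciSup (f := fun i => ⨆ j, |T i j|) (finite_range _).bddAbove i)

theorem entrySup_le_nu1Mat {m n : ℕ} (T : Matrix (Fin m) (Fin n) ℝ) : entrySup T ≤ nu1Mat T := by
  refine le_csInf ⟨_, n, fun j => Pi.single j 1, fun j i => T i j, fun a b => ?_, rfl⟩ ?_
  · simp [Pi.single_apply]
  · rintro _ ⟨s, x, y, hT, rfl⟩
    have h0 : 0 ≤ ∑ i, supNorm (x i) * supNorm (y i) :=
      Finset.sum_nonneg fun i _ => mul_nonneg (supNorm_nonneg _) (supNorm_nonneg _)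
    refine Real.iSup_le (fun a => Real.iSup_le (fun b => ?_) h0) h0
    rw [hT]
    refine (Finset.abs_sum_le_sum_abs _ _).trans (Finset.sum_le_sum fun i _ => ?_)
    rw [abs_mul, mul_comm]
    exact mul_le_mul (abs_le_supNorm _ _) (abs_le_supNorm _ _) (abs_nonneg _) (supNorm_nonneg _)

/-- A combination of rank-one matrices with entries in `[-1, 1]` bounds the 1-nuclear norm. -/
theorem nu1Mat_le_sum {m n : ℕ} {T : Matrix (Fin m) (Fin n) ℝ} {κ : Type*} [Fintype κ]
    {w : κ → ℝ} (hw : ∀ k, 0 ≤ w k) {y : κ → Fin m → ℝ} {x : κ → Fin n → ℝ}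
    (hy : ∀ k a, |y k a| ≤ 1) (hx : ∀ k b, |x k b| ≤ 1)
    (hT : ∀ a b, T a b = ∑ k, w k * (y k a * x k b)) : nu1Mat T ≤ ∑ k, w k := by
  let e := (Fintype.equivFin κ).symm
  have hbdd : BddBelow {c | ∃ (s : ℕ) (x : Fin s → (Fin n → ℝ)) (y : Fin s → (Fin m → ℝ)),
      (∀ a b, T a b = ∑ i, y i a * x i b) ∧ c = ∑ i, supNorm (x i) * supNorm (y i)} := by
    refine ⟨0, ?_⟩
    rintro _ ⟨s, x, y, -, rfl⟩
    exact Finset.sum_nonneg fun i _ => mul_nonneg (supNorm_nonneg _) (supNorm_nonneg _)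
  refine (csInf_le hbdd ⟨_, fun k => x (e k), fun k => w (e k) • y (e k), fun a b => ?_, rfl⟩).trans
    ?_
  · rw [hT, ← e.sum_comp]
    simp [mul_assoc]
  · rw [← e.sum_comp w]
    refine Finset.sum_le_sum fun k _ => ?_
    have h1 : supNorm (x (e k)) ≤ 1 := supNorm_le zero_le_one (hx _)
    have h2 : supNorm (w (e k) • y (e k)) ≤ w (e k) := supNorm_le (hw _) fun a => by
      simpa [abs_mul, abs_of_nonneg (hw _)] using mul_le_mul_of_nonneg_left (hy (e k) a) (hw _)
    simpa using mul_le_mul h1 h2 (supNorm_nonneg _) zero_le_one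

/-- Every matrix `T` factors as `U * V` where `U` has `T.rank` linearly independent columns. -/
theorem Matrix.exists_rank_factorization {m n : ℕ} (T : Matrix (Fin m) (Fin n) ℝ) :
    ∃ (d : ℕ) (U : Matrix (Fin m) (Fin d) ℝ) (V : Matrix (Fin d) (Fin n) ℝ),
      d = T.rank ∧ T = U * V ∧ Function.Injective U.mulVec := by
  let b : Module.Basis (Fin T.rank) ℝ (LinearMap.range T.mulVecLin) :=
    Module.finBasisOfFinrankEq ℝ _ rfl
  have key (c : Fin T.rank → ℝ) :
      (Matrix.of fun i k => (b k : Fin m → ℝ) i) *ᵥ c = ((b.equivFun.symm c : _) : Fin m → ℝ) := by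
    ext i
    simp [Matrix.mulVec, dotProduct, Module.Basis.equivFun_symm_apply, mul_comm]
  refine ⟨T.rank, Matrix.of fun i k => (b k : Fin m → ℝ) i,
    Matrix.of fun k j => b.equivFun ⟨T.mulVecLin (Pi.single j 1), LinearMap.mem_range_self _ _⟩ k,
    rfl, ?_, ?_⟩
  · ext i j
    have := congrFun
      (key (b.equivFun ⟨T.mulVecLin (Pi.single j 1), LinearMap.mem_range_self _ _⟩)) i
    rw [LinearEquiv.symm_apply_apply] at this
    simpa [Matrix.mul_apply, Matrix.mulVec, dotProduct, Pi.single_apply] using this.symm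
  · intro c c' h
    simp only [key] at h
    exact b.equivFun.symm.injective (Subtype.ext h)

/-- The function in the hypothesis takes the value `1` and has slope `q - d` at `t = 0`. -/
theorem le_of_forall_pow_mul_le_one {d : ℕ} (hd : 0 < d) {q : ℝ}
    (h : ∀ t ∈ Ioo (0 : ℝ) 1, (1 - t) ^ (d - 1) * (1 - t + t * q) ≤ 1) : q ≤ d := by
  obtain ⟨k, rfl⟩ : ∃ k, d = k + 1 := ⟨d - 1, by omega⟩
  simp only [Nat.add_sub_cancel] at h
  by_contra! hq
  push_cast at hq
  have hder : HasDerivAt (fun t : ℝ => (1 - t) ^ k * (1 - t + t * q)) (q - (k + 1)) 0 := by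
    have h1 : HasDerivAt (fun t : ℝ => 1 - t) (-1) 0 := by
      simpa using (hasDerivAt_id (0 : ℝ)).const_sub 1
    have h2 : HasDerivAt (fun t : ℝ => 1 - t + t * q) (-1 + q) 0 := by
      simpa using h1.fun_add ((hasDerivAt_id' (0 : ℝ)).mul_const q)
    refine ((h1.fun_pow k).fun_mul h2).congr_deriv ?_
    simp
    ring
  have hev := hder.tendsto_slope_zero_right.eventually (lt_mem_nhds (sub_pos.2 hq))
  obtain ⟨t, ht, ht01⟩ := (hev.and (Ioo_mem_nhdsGT (zero_lt_one (α := ℝ)))).exists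
  have := h t ht01
  simp at ht
  rw [mul_pos_iff_of_pos_left (inv_pos.2 ht01.1)] at ht
  linarith

/-- The determinant along the segment from `M` to a rank-one matrix. -/
theorem det_combination_vecMulVec {d : ℕ} (hd : 0 < d) {M : Matrix (Fin d) (Fin d) ℝ}
    (hM : IsUnit M.det) (u : Fin d → ℝ) {t : ℝ} (ht : t ∈ Ioo (0 : ℝ) 1) :
    ((1 - t) • M + t • vecMulVec u u).det =
      M.det * ((1 - t) ^ (d - 1) * (1 - t + t * (u ⬝ᵥ M⁻¹ *ᵥ u))) := by
  obtain ⟨k, rfl⟩ : ∃ k, d = k + 1 := ⟨d - 1, by omega⟩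
  have h1 : (1 - t) ≠ 0 := by linarith [ht.2]
  have : (1 - t) • M + t • vecMulVec u u
      = ((1 - t) • M) *
        (1 + replicateCol Unit ((t / (1 - t)) • M⁻¹ *ᵥ u) * replicateRow Unit u) := by
    rw [mul_add, mul_one, ← vecMulVec_eq, mul_vecMulVec, mulVec_smul, smul_mulVec, mulVec_mulVec,
      mul_nonsing_inv _ hM, one_mulVec, smul_smul, div_mul_cancel₀ _ h1, smul_vecMulVec]
  rw [this, det_mul, det_smul, det_one_add_replicateCol_mul_replicateRow]
  simp
  field_simp
  ring

/-- **Kiefer–Wolfowitz**: the weights maximizing the determinant of the information matrix `M` of a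
design bound every variance `uᵢᵀ M⁻¹ uᵢ` by the dimension. -/
theorem exists_optimal_design {m d : ℕ} (hd : 0 < d) (U : Matrix (Fin m) (Fin d) ℝ)
    (hU : Function.Injective U.mulVec) :
    ∃ p ∈ stdSimplex ℝ (Fin m), (Uᵀ * Matrix.diagonal p * U).PosDef ∧
      ∀ i, U i ⬝ᵥ (Uᵀ * Matrix.diagonal p * U)⁻¹ *ᵥ U i ≤ d := by
  have : NeZero d := ⟨hd.ne'⟩
  have : Nonempty (Fin m) := by
    by_contra! hm
    obtain ⟨c, hc⟩ := exists_ne (0 : Fin d → ℝ)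
    exact hc (hU (Subsingleton.elim _ _))
  have hcont : Continuous fun p : Fin m → ℝ => (Uᵀ * Matrix.diagonal p * U).det := by fun_prop
  obtain ⟨p, hp, hmax⟩ := (isCompact_stdSimplex ℝ (Fin m)).exists_isMaxOn
    ⟨_, single_mem_stdSimplex ℝ (Classical.arbitrary (Fin m))⟩ hcont.continuousOn
  have hpsd : (Uᵀ * Matrix.diagonal p * U).PosSemidef := by
    simpa using (PosSemidef.diagonal (d := p) hp.1).conjTranspose_mul_mul_same U
  have hm : (0 : ℝ) < Fintype.card (Fin m) := by exact_mod_cast Fintype.card_pos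
  let q : Fin m → ℝ := fun _ => (Fintype.card (Fin m) : ℝ)⁻¹
  have hunif : q ∈ stdSimplex ℝ (Fin m) :=
    ⟨fun _ => by positivity, by
      rw [Finset.sum_const, Finset.card_univ, nsmul_eq_mul, mul_inv_cancel₀ hm.ne']⟩
  have hposU : (Uᵀ * Matrix.diagonal q * U).PosDef := by
    simpa using
      (PosDef.diagonal (d := q) fun _ => inv_pos.2 hm).conjTranspose_mul_mul_same (B := U) hU
  have hdet : 0 < (Uᵀ * Matrix.diagonal p * U).det := hposU.det_pos.trans_le (hmax hunif)
  refine ⟨p, hp, hpsd.posDef_iff_det_ne_zero.2 hdet.ne', fun i => ?_⟩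
  refine le_of_forall_pow_mul_le_one hd fun t ht => ?_
  have hmem : (1 - t) • p + t • Pi.single i 1 ∈ stdSimplex ℝ (Fin m) :=
    convex_stdSimplex ℝ (Fin m) hp (single_mem_stdSimplex ℝ i) (by linarith [ht.2]) ht.1.le
      (by ring)
  have hle : (Uᵀ * Matrix.diagonal ((1 - t) • p + t • Pi.single i 1) * U).det
      ≤ (Uᵀ * Matrix.diagonal p * U).det := hmax hmem
  have heq : Uᵀ * Matrix.diagonal ((1 - t) • p + t • Pi.single i 1) * U
      = (1 - t) • (Uᵀ * Matrix.diagonal p * U) + t • vecMulVec (U i) (U i) := by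
    ext a b
    rw [Matrix.mul_apply, Matrix.add_apply, Matrix.smul_apply, Matrix.mul_apply]
    simp [-Matrix.diagonal_add, Matrix.mul_diagonal, vecMulVec_apply, mul_add, add_mul,
      Finset.sum_add_distrib, Finset.mul_sum, Pi.single_apply]
    congr 1
    · exact Finset.sum_congr rfl fun _ _ => by ring
    · ring
  rw [heq, det_combination_vecMulVec hd hdet.ne'.isUnit _ ht] at hle
  exact le_of_mul_le_mul_left (by simpa using hle) hdet

/-- A matrix of rank at most `r` with entries bounded by `τ` is `√r * τ` times an off-diagonal block
of a correlation matrix. -/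
theorem exists_correlation_matrix {m n r : ℕ} (T : Matrix (Fin m) (Fin n) ℝ) (hr : T.rank ≤ r)
    {τ : ℝ} (hτ : 0 < τ) (hT : ∀ i j, |T i j| ≤ τ) (hrank : 0 < T.rank) :
    ∃ W : Matrix (Fin m ⊕ Fin n) (Fin m ⊕ Fin n) ℝ, W.PosSemidef ∧ (∀ a, W a a = 1) ∧
      ∀ i j, T i j = √r * τ * W (Sum.inl i) (Sum.inr j) := by
  obtain ⟨d, U, V, hd, hUV, hU⟩ := T.exists_rank_factorization
  rw [← hd] at hrank hr
  obtain ⟨p, hp, hM, hle⟩ := exists_optimal_design hrank U hU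
  set M := Uᵀ * Matrix.diagonal p * U with hMdef
  have hr0 : 0 < √(r : ℝ) := Real.sqrt_pos.2 (by exact_mod_cast hrank.trans_le hr)
  let R : Matrix (Fin d) (Fin m ⊕ Fin n) ℝ := fromCols ((√r)⁻¹ • Uᵀ) (τ⁻¹ • (M * V))
  have hG : (Rᵀ * M⁻¹ * R).PosSemidef := by
    simpa using hM.inv.posSemidef.conjTranspose_mul_mul_same R
  have hdetM : IsUnit M.det := hM.det_pos.ne'.isUnit
  have hMt : Mᵀ = M := by simpa using hM.isHermitian.eq
  have hblock : Rᵀ * M⁻¹ * R = fromBlocks ((r : ℝ)⁻¹ • (U * M⁻¹ * Uᵀ)) ((√r * τ)⁻¹ • T)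
      ((√r * τ)⁻¹ • Tᵀ) ((τ ^ 2)⁻¹ • (Vᵀ * M * V)) := by
    have h1 : M⁻¹ * (M * V) = V := by
      rw [← Matrix.mul_assoc, nonsing_inv_mul _ hdetM, Matrix.one_mul]
    have h2 : Vᵀ * M * M⁻¹ = Vᵀ := by
      rw [Matrix.mul_assoc, mul_nonsing_inv _ hdetM, Matrix.mul_one]
    simp only [R, transpose_fromCols, fromRows_mul, mul_fromCols, transpose_smul,
      transpose_transpose, transpose_mul, hMt, Matrix.smul_mul, Matrix.mul_smul,
      h2, Matrix.mul_assoc, h1]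
    ext (i | i) (j | j) <;> simp [hUV]
    · rw [← mul_assoc, ← mul_inv, Real.mul_self_sqrt (Nat.cast_nonneg r)]
    · ring
    · ring
    · ring
  have hdiag (a) : (Rᵀ * M⁻¹ * R) a a ≤ 1 := by
    rw [hblock]
    rcases a with i | j
    · have hi : (U * M⁻¹ * Uᵀ) i i = U i ⬝ᵥ M⁻¹ *ᵥ U i := by
        rw [dotProduct_mulVec]; rfl
      have : (U * M⁻¹ * Uᵀ) i i ≤ r := hi ▸ (hle i).trans (by exact_mod_cast hr)
      have hr1 : (0 : ℝ) < r := Real.sqrt_pos.1 hr0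
      simpa using (inv_mul_le_one₀ hr1).2 this
    · have hj : (Vᵀ * M * V) j j = ∑ i, p i * T i j ^ 2 := by
        have : Vᵀ * M * V = Tᵀ * Matrix.diagonal p * T := by
          rw [hMdef, hUV, transpose_mul]; simp only [Matrix.mul_assoc]
        rw [this, Matrix.mul_apply]
        exact Finset.sum_congr rfl fun i _ => by simp [Matrix.mul_diagonal]; ring
      have : (Vᵀ * M * V) j j ≤ τ ^ 2 := by
        rw [hj]
        calc ∑ i, p i * T i j ^ 2 ≤ ∑ i, p i * τ ^ 2 := by
              refine Finset.sum_le_sum fun i _ => mul_le_mul_of_nonneg_left ?_ (hp.1 i)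
              exact sq_le_sq' (neg_le_of_abs_le (hT i j)) (le_of_abs_le (hT i j))
          _ = τ ^ 2 := by rw [← Finset.sum_mul, hp.2, one_mul]
      simpa using (inv_mul_le_one₀ (by positivity)).2 this
  refine ⟨Rᵀ * M⁻¹ * R + Matrix.diagonal fun a => 1 - (Rᵀ * M⁻¹ * R) a a,
    hG.add (PosSemidef.diagonal fun a => sub_nonneg.2 (hdiag a)), fun a => by simp, fun i j => ?_⟩
  rw [hblock]
  simp
  field_simp

/-- Entrywise powers of a positive semidefinite matrix are positive semidefinite. -/
theorem Matrix.PosSemidef.map_pow {ι : Type*} [Fintype ι] {W : Matrix ι ι ℝ} (hW : W.PosSemidef)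
    (k : ℕ) : (W.map (· ^ k)).PosSemidef := by
  induction k with
  | zero =>
    have := posSemidef_vecMulVec_self_star (fun _ : ι => (1 : ℝ))
    convert this using 1
    ext; simp [vecMulVec_apply]
  | succ k ih =>
    have h : W.map (· ^ (k + 1)) = W.map (· ^ k) ⊙ W := by ext; simp [pow_succ]
    exact h ▸ ih.hadamard hW

theorem Matrix.PosSemidef.of_hasSum {ι : Type*} [Fintype ι] {A : ℕ → Matrix ι ι ℝ}
    {G : Matrix ι ι ℝ} (hA : ∀ k, (A k).PosSemidef)
    (hG : ∀ a b, HasSum (fun k => A k a b) (G a b)) : G.PosSemidef := by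
  refine .of_dotProduct_mulVec_nonneg ?_ fun x => ?_
  · ext a b
    refine (hG b a).unique ?_
    convert hG a b using 2 with k
    simpa using (hA k).isHermitian.apply a b
  · have : HasSum (fun k => star x ⬝ᵥ (A k *ᵥ x)) (star x ⬝ᵥ (G *ᵥ x)) :=
      hasSum_sum fun a _ => (hasSum_sum fun b _ => (hG a b).mul_right (x b)).mul_left (star x a)
    exact this.nonneg fun k => (hA k).dotProduct_mulVec_nonneg x

/-- **Krivine's trick**: applying `sinh (c * ·)` to the diagonal blocks and `sin (c * ·)` to the
off-diagonal blocks preserves positive semidefiniteness. -/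
theorem krivine_posSemidef {α β : Type*} [Fintype α] [Fintype β] {W : Matrix (α ⊕ β) (α ⊕ β) ℝ}
    (hW : W.PosSemidef) {c : ℝ} (hc : 0 ≤ c) :
    (fromBlocks (W.toBlocks₁₁.map fun x => sinh (c * x)) (W.toBlocks₁₂.map fun x => sin (c * x))
      (W.toBlocks₂₁.map fun x => sin (c * x))
      (W.toBlocks₂₂.map fun x => sinh (c * x))).PosSemidef := by
  let e : α ⊕ β → ℝ := Sum.elim (fun _ => 1) (fun _ => -1)
  refine PosSemidef.of_hasSum (A := fun k => (c ^ (2 * k + 1) / (2 * k + 1).factorial) •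
    ((vecMulVec e (star e)).map (· ^ k) ⊙ W.map (· ^ (2 * k + 1)))) (fun k => ?_) ?_
  · exact (((posSemidef_vecMulVec_self_star e).map_pow k).hadamard (hW.map_pow _)).smul
      (by positivity)
  · rintro (a | a) (b | b)
    · refine (Real.hasSum_sinh (c * W (.inl a) (.inl b))).congr_fun fun k => ?_
      simp [e, vecMulVec_apply]; ring
    · refine (Real.hasSum_sin (c * W (.inl a) (.inr b))).congr_fun fun k => ?_
      simp [e, vecMulVec_apply]; ring
    · refine (Real.hasSum_sin (c * W (.inr a) (.inl b))).congr_fun fun k => ?_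
      simp [e, vecMulVec_apply]; ring
    · refine (Real.hasSum_sinh (c * W (.inr a) (.inr b))).congr_fun fun k => ?_
      simp [e, vecMulVec_apply]; ring

theorem krivine_constant_le : π / (2 * arsinh 1) ≤ 1.79 := by
  have h : (0.8777 : ℝ) ≤ arsinh 1 := by
    rw [← Real.exp_le_exp, exp_arsinh]
    have h1 : (1.4142 : ℝ) ≤ √(1 + 1 ^ 2) := Real.le_sqrt_of_sq_le (by norm_num)
    have h2 := Real.exp_bound' (x := 0.8777) (by norm_num) (by norm_num) (n := 8) (by norm_num)
    refine h2.trans (le_trans ?_ (add_le_add_right h1 1))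
    norm_num [Finset.sum_range_succ, Nat.factorial]
  rw [div_le_iff₀ (by linarith)]
  linarith [Real.pi_lt_d4]

/-- The entries of a correlation matrix lie in `[-1, 1]`. -/
theorem Matrix.PosSemidef.abs_apply_le_one {ι : Type*} [Fintype ι] [DecidableEq ι]
    {W : Matrix ι ι ℝ} (hW : W.PosSemidef) (hdiag : ∀ a, W a a = 1) (a b : ι) :
    |W a b| ≤ 1 := by
  have hsymm : W b a = W a b := by simpa using hW.isHermitian.apply a b
  have h1 := hW.dotProduct_mulVec_nonneg (Pi.single a 1 + Pi.single b 1)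
  have h2 := hW.dotProduct_mulVec_nonneg (Pi.single a 1 - Pi.single b 1)
  simp [mulVec_add, mulVec_sub, hdiag, hsymm] at h1 h2
  rw [abs_le]
  constructor <;> linarith

/-- Rotation invariance: the radial and angular parts of a standard Gaussian pair separate when
integrating a function that is homogeneous of degree zero. -/
theorem integral_gaussian_prod_eq_mul {F : ℝ × ℝ → ℝ}
    (hF : ∀ r > 0, ∀ x y, F (r * x, r * y) = F (x, y)) :
    ∫ p, F p ∂((gaussianReal 0 1).prod (gaussianReal 0 1)) =
      (∫ r in Ioi (0 : ℝ), r * (gaussianPDFReal 0 1 0 * gaussianPDFReal 0 1 r)) *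
        ∫ θ in Ioo (-π) π, F (cos θ, sin θ) := by
  rw [gaussianReal_of_var_ne_zero _ one_ne_zero, prod_withDensity (by fun_prop) (by fun_prop),
    integral_withDensity_eq_integral_toReal_smul (by fun_prop)
      (ae_of_all _ fun p => ENNReal.mul_lt_top gaussianPDF_lt_top gaussianPDF_lt_top),
    ← Measure.volume_eq_prod, ← integral_comp_polarCoord_symm, ← setIntegral_prod_mul]
  refine setIntegral_congr_fun polarCoord.open_target.measurableSet fun p hp => ?_
  have hp0 : 0 < p.1 := hp.1
  simp only [polarCoord_symm_apply, hF _ hp0, ENNReal.toReal_mul, toReal_gaussianPDF, smul_eq_mul]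
  have : gaussianPDFReal 0 1 (p.1 * cos p.2) * gaussianPDFReal 0 1 (p.1 * sin p.2)
      = gaussianPDFReal 0 1 0 * gaussianPDFReal 0 1 p.1 := by
    simp only [gaussianPDFReal]
    rw [mul_mul_mul_comm, ← Real.exp_add, mul_mul_mul_comm, ← Real.exp_add]
    congr 2
    have := sin_sq_add_cos_sq p.2
    simp
    linear_combination (-p.1 ^ 2 / 2) * this
  rw [this]
  ring

theorem integral_gaussian_prod_of_homogeneous {F : ℝ × ℝ → ℝ}
    (hF : ∀ r > 0, ∀ x y, F (r * x, r * y) = F (x, y)) :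
    ∫ p, F p ∂((gaussianReal 0 1).prod (gaussianReal 0 1)) =
      (2 * π)⁻¹ * ∫ θ in (-π)..π, F (cos θ, sin θ) := by
  have h1 := integral_gaussian_prod_eq_mul (F := fun _ => 1) fun _ _ _ _ => rfl
  have hpi : (0 : ℝ) ≤ π + π := by positivity
  simp [hpi] at h1
  rw [integral_gaussian_prod_eq_mul hF, intervalIntegral.integral_of_le (by linarith [pi_pos]),
    integral_Ioc_eq_integral_Ioo]
  congr 1
  exact eq_inv_of_mul_eq_one_left (by rw [two_mul, ← h1])

/-- A sign function without the value zero. -/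
noncomputable def strictSign (x : ℝ) : ℝ := if 0 ≤ x then 1 else -1

theorem measurable_strictSign : Measurable strictSign :=
  Measurable.ite measurableSet_Ici measurable_const measurable_const

theorem strictSign_of_pos {x : ℝ} (h : 0 < x) : strictSign x = 1 := if_pos h.le

theorem strictSign_of_neg {x : ℝ} (h : x < 0) : strictSign x = -1 := if_neg h.not_ge

theorem strictSign_mul_of_pos {r : ℝ} (hr : 0 < r) (x : ℝ) :
    strictSign (r * x) = strictSign x := by
  simp [strictSign, mul_nonneg_iff_of_pos_left hr]

theorem abs_strictSign (x : ℝ) : |strictSign x| = 1 := by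
  unfold strictSign; split_ifs <;> simp

theorem integral_strictSign_cos_mul {φ : ℝ} (h0 : 0 ≤ φ) (hπ : φ ≤ π) :
    ∫ θ in (-π)..π, strictSign (cos θ) * strictSign (cos (θ - φ)) = 2 * π - 4 * φ := by
  set f : ℝ → ℝ := fun θ => strictSign (cos θ) * strictSign (cos (θ - φ))
  have hper : Function.Periodic f (2 * π) := fun θ => by
    simp only [f, cos_add_two_pi, show θ + 2 * π - φ = θ - φ + 2 * π by ring]
  have hint (a b : ℝ) : IntervalIntegrable f volume a b := by
    refine IntervalIntegrable.mono_fun' (g := fun _ => (1 : ℝ)) (by simp) ?_ ?_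
    · exact ((measurable_strictSign.comp (by fun_prop)).mul
        (measurable_strictSign.comp (by fun_prop))).aestronglyMeasurable
    · exact ae_of_all _ fun θ => by simp [f, abs_strictSign]
  have hconst {a b c : ℝ} (hab : a ≤ b) (h : ∀ θ ∈ Ioo a b, f θ = c) :
      ∫ θ in a..b, f θ = (b - a) * c := by
    rw [intervalIntegral.integral_of_le hab, integral_Ioc_eq_integral_Ioo,
      setIntegral_congr_fun measurableSet_Ioo h]
    simp [hab]
  have hshift : ∫ θ in (-π)..π, f θ = ∫ θ in (-(π / 2))..(-(π / 2) + 2 * π), f θ := by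
    rw [← hper.intervalIntegral_add_eq (-π)]
    congr 1; ring
  rw [hshift, ← intervalIntegral.integral_add_adjacent_intervals (hint _ (φ - π / 2)) (hint _ _),
    ← intervalIntegral.integral_add_adjacent_intervals (hint (φ - π / 2) (π / 2)) (hint _ _),
    ← intervalIntegral.integral_add_adjacent_intervals (hint (π / 2) (φ + π / 2)) (hint _ _),
    hconst (c := -1) (by linarith), hconst (c := 1) (by linarith), hconst (c := -1) (by linarith),
    hconst (c := 1) (by linarith)]
  · ring
  · rintro θ ⟨h1, h2⟩
    have hc : cos θ < 0 := cos_neg_of_pi_div_two_lt_of_lt (by linarith) (by linarith)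
    have hc' : cos (θ - φ) < 0 := cos_neg_of_pi_div_two_lt_of_lt (by linarith) (by linarith)
    simp [f, strictSign_of_neg hc, strictSign_of_neg hc']
  · rintro θ ⟨h1, h2⟩
    have hc : cos θ < 0 := cos_neg_of_pi_div_two_lt_of_lt (by linarith) (by linarith)
    have hc' : 0 < cos (θ - φ) := cos_pos_of_mem_Ioo ⟨by linarith, by linarith⟩
    simp [f, strictSign_of_neg hc, strictSign_of_pos hc']
  · rintro θ ⟨h1, h2⟩
    have hc : 0 < cos θ := cos_pos_of_mem_Ioo ⟨by linarith, by linarith⟩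
    have hc' : 0 < cos (θ - φ) := cos_pos_of_mem_Ioo ⟨by linarith, by linarith⟩
    simp [f, strictSign_of_pos hc, strictSign_of_pos hc']
  · rintro θ ⟨h1, h2⟩
    have hc : 0 < cos θ := cos_pos_of_mem_Ioo ⟨by linarith, by linarith⟩
    have hc' : cos (θ - φ) < 0 := by
      rw [← cos_neg]
      exact cos_neg_of_pi_div_two_lt_of_lt (by linarith) (by linarith)
    simp [f, strictSign_of_pos hc, strictSign_of_neg hc']

/-- Two coordinates of a Gaussian vector with unit variances and covariance `cos φ` are distributed
as `(X, cos φ * X + sin φ * Y)` for independent standard Gaussians `X` and `Y`. -/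
theorem map_pair_multivariateGaussian {ι : Type*} [Fintype ι] [DecidableEq ι] {G : Matrix ι ι ℝ}
    (hG : G.PosSemidef) (hdiag : ∀ a, G a a = 1) (a b : ι) {φ : ℝ} (hφ : cos φ = G a b) :
    (multivariateGaussian 0 G).map (fun x => !₂[x a, x b]) =
      ((gaussianReal 0 1).prod (gaussianReal 0 1)).map
        (fun p => !₂[p.1, cos φ * p.1 + sin φ * p.2]) := by
  have := Measure.isProbabilityMeasure_map (μ := multivariateGaussian 0 G)
    (f := fun x => !₂[x a, x b]) (by fun_prop)
  have := Measure.isProbabilityMeasure_map (μ := (gaussianReal 0 1).prod (gaussianReal 0 1))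
    (f := fun p => !₂[p.1, cos φ * p.1 + sin φ * p.2]) (by fun_prop)
  refine Measure.ext_of_charFun (funext fun t => ?_)
  rw [charFun_apply, charFun_apply, integral_map (by fun_prop) (by fun_prop),
    integral_map (by fun_prop) (by fun_prop)]
  have hL : ∀ x : EuclideanSpace ℝ ι, inner ℝ !₂[x a, x b] t =
      inner ℝ x (EuclideanSpace.single a (t 0) + EuclideanSpace.single b (t 1)) := by
    intro x
    simp [PiLp.inner_apply, Fin.sum_univ_two, inner_add_right]
  have hR : ∀ p : ℝ × ℝ, Complex.exp
      ((inner ℝ !₂[p.1, cos φ * p.1 + sin φ * p.2] t : ℝ) * Complex.I) =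
      Complex.exp ((t 0 + t 1 * cos φ : ℝ) * p.1 * Complex.I) *
        Complex.exp ((t 1 * sin φ : ℝ) * p.2 * Complex.I) := by
    intro p
    rw [← Complex.exp_add]
    congr 1
    simp [PiLp.inner_apply, Fin.sum_univ_two]
    ring
  simp only [hL, hR]
  rw [← charFun_apply, charFun_multivariateGaussian hG,
    integral_prod_mul (fun x : ℝ => Complex.exp ((t 0 + t 1 * cos φ : ℝ) * x * Complex.I))
      (fun y : ℝ => Complex.exp ((t 1 * sin φ : ℝ) * y * Complex.I)),
    ← charFun_apply_real, ← charFun_apply_real, charFun_gaussianReal, charFun_gaussianReal,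
    ← Complex.exp_add]
  congr 1
  have hsymm : G b a = G a b := by simpa using hG.isHermitian.apply a b
  have key : (WithLp.ofLp (EuclideanSpace.single a (t 0) + EuclideanSpace.single b (t 1))) ⬝ᵥ
      G *ᵥ (WithLp.ofLp (EuclideanSpace.single a (t 0) + EuclideanSpace.single b (t 1)))
      = (t 0 + t 1 * cos φ) ^ 2 + (t 1 * sin φ) ^ 2 := by
    simp [mulVec_add, hdiag, hsymm, ← hφ]
    linear_combination (-t 1 ^ 2) * sin_sq_add_cos_sq φ
  rw [key]
  simp
  ring

/-- **Grothendieck's identity**: the sign correlation of two standard Gaussians. -/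
theorem integral_strictSign_mul_strictSign {ι : Type*} [Fintype ι] [DecidableEq ι]
    {G : Matrix ι ι ℝ} (hG : G.PosSemidef) (hdiag : ∀ a, G a a = 1) (a b : ι) :
    ∫ x, strictSign (x a) * strictSign (x b) ∂(multivariateGaussian 0 G) =
      2 / π * arcsin (G a b) := by
  have hab := hG.abs_apply_le_one hdiag a b
  have hcos : cos (arccos (G a b)) = G a b := cos_arccos (abs_le.1 hab).1 (abs_le.1 hab).2
  let S : EuclideanSpace ℝ (Fin 2) → ℝ := fun z => strictSign (z 0) * strictSign (z 1)
  have hS : Measurable S := (measurable_strictSign.comp (by fun_prop)).mul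
    (measurable_strictSign.comp (by fun_prop))
  have h1 := integral_map (μ := multivariateGaussian 0 G) (φ := fun x => !₂[x a, x b])
    (by fun_prop) hS.aestronglyMeasurable
  rw [map_pair_multivariateGaussian hG hdiag a b hcos, integral_map (by fun_prop)
    hS.aestronglyMeasurable, integral_gaussian_prod_of_homogeneous] at h1
  · have h2 := integral_strictSign_cos_mul (arccos_nonneg (G a b)) (arccos_le_pi (G a b))
    simp only [S, cons_val_zero, cons_val_one] at h1
    rw [← h1]
    simp only [cos_sub, mul_comm (cos (arccos _)), mul_comm (sin (arccos _))] at h2 ⊢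
    rw [h2, arccos]
    field_simp
    ring
  · intro r hr x y
    simp only [S, cons_val_zero, cons_val_one]
    rw [strictSign_mul_of_pos hr, ← strictSign_mul_of_pos hr (_ * x + _)]
    ring_nf

/-- Averages of products of signs of coordinates are finite convex combinations of sign patterns. -/
theorem exists_sign_decomposition {ι : Type*} [Fintype ι] [DecidableEq ι]
    (μ : Measure (EuclideanSpace ℝ ι)) [IsProbabilityMeasure μ] :
    ∃ (w : (ι → Bool) → ℝ) (ε : (ι → Bool) → ι → ℝ), (∀ σ, 0 ≤ w σ) ∧ ∑ σ, w σ = 1 ∧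
      (∀ σ a, |ε σ a| ≤ 1) ∧
      ∀ a b, ∫ x, strictSign (x a) * strictSign (x b) ∂μ = ∑ σ, w σ * (ε σ a * ε σ b) := by
  let P : EuclideanSpace ℝ ι → ι → Bool := fun x a => decide (0 ≤ x a)
  have hP : Measurable P := measurable_pi_lambda _ fun a =>
    measurable_to_bool (by
      convert measurableSet_le (measurable_const (a := (0 : ℝ)))
        (by fun_prop : Measurable fun x : EuclideanSpace ℝ ι => x a) using 1
      ext x
      simp [P])
  have : IsProbabilityMeasure (μ.map P) := Measure.isProbabilityMeasure_map hP.aemeasurable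
  refine ⟨fun σ => (μ.map P).real {σ}, fun σ a => if σ a then 1 else -1,
    fun σ => measureReal_nonneg, ?_, fun σ a => ?_, fun a b => ?_⟩
  · simp
  · dsimp only
    split_ifs <;> simp
  · have h := integral_fintype (μ := μ.map P)
      (f := fun σ => (if σ a then (1 : ℝ) else -1) * (if σ b then 1 else -1)) .of_finite
    rw [integral_map hP.aemeasurable .of_discrete] at h
    simpa [P, strictSign] using h

theorem arsinh_one_pos : 0 < arsinh 1 := arsinh_pos_iff.2 one_pos

theorem arsinh_one_le_one : arsinh 1 ≤ 1 := by
  rw [← sinh_le_sinh, sinh_arsinh]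
  exact self_le_sinh_iff.2 zero_le_one

/-- **Grothendieck's inequality** with Krivine's constant, in its dual form. -/
theorem nu1Mat_le_of_correlation {m n : ℕ} {T : Matrix (Fin m) (Fin n) ℝ}
    {W : Matrix (Fin m ⊕ Fin n) (Fin m ⊕ Fin n) ℝ} (hW : W.PosSemidef) (hdiag : ∀ a, W a a = 1)
    {γ : ℝ} (hγ : 0 ≤ γ) (hT : ∀ i j, T i j = γ * W (Sum.inl i) (Sum.inr j)) :
    nu1Mat T ≤ π / (2 * arsinh 1) * γ := by
  have hc := arsinh_one_pos
  set c := arsinh 1 with hcdef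
  let G := fromBlocks (W.toBlocks₁₁.map fun x => sinh (c * x))
    (W.toBlocks₁₂.map fun x => sin (c * x)) (W.toBlocks₂₁.map fun x => sin (c * x))
    (W.toBlocks₂₂.map fun x => sinh (c * x))
  have hG : G.PosSemidef := krivine_posSemidef hW hc.le
  have hGdiag (a) : G a a = 1 := by
    rcases a with a | a <;> simp [G, toBlocks₁₁, toBlocks₂₂, hdiag, hcdef]
  obtain ⟨w, ε, hw, hw1, hε, hint⟩ := exists_sign_decomposition (multivariateGaussian 0 G)
  have hrep (i : Fin m) (j : Fin n) : T i j =
      ∑ σ, (π / (2 * c) * γ * w σ) * (ε σ (Sum.inl i) * ε σ (Sum.inr j)) := by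
    have hGij : G (Sum.inl i) (Sum.inr j) = sin (c * W (Sum.inl i) (Sum.inr j)) := rfl
    have hWij := abs_le.1 (hW.abs_apply_le_one hdiag (Sum.inl i) (Sum.inr j))
    have hc1 : c ≤ 1 := arsinh_one_le_one
    have hpi := Real.pi_gt_three
    have h := integral_strictSign_mul_strictSign hG hGdiag (Sum.inl i) (Sum.inr j)
    rw [hint, hGij, arcsin_sin (by nlinarith) (by nlinarith)] at h
    simp_rw [mul_assoc _ (w _), ← Finset.mul_sum]
    rw [h, hT]
    field_simp
  refine (nu1Mat_le_sum (fun σ => by have := hw σ; positivity) (fun σ a => hε σ (Sum.inl a))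
    (fun σ b => hε σ (Sum.inr b)) hrep).trans_eq ?_
  rw [← Finset.mul_sum, hw1, mul_one]

theorem stmt_3 :
    ∃ K : ℝ, K ≤ 1.79 ∧
    ∀ (m n r : ℕ), 0 < m → 0 < n → 0 < r →
    ∀ T : Matrix (Fin m) (Fin n) ℝ, T.rank ≤ r →
      entrySup T ≤ nu1Mat T ∧ nu1Mat T ≤ K * Real.sqrt r * entrySup T := by
  refine ⟨π / (2 * arsinh 1), krivine_constant_le, fun m n r _ _ _ T hr =>
    ⟨entrySup_le_nu1Mat T, ?_⟩⟩
  have h0 : 0 ≤ entrySup T := Real.iSup_nonneg fun i => supNorm_nonneg (T i)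
  rcases eq_or_ne T 0 with rfl | hT
  · have hc := arsinh_one_pos
    refine (nu1Mat_le_sum (κ := Empty) (w := Empty.elim) (x := Empty.elim) (y := Empty.elim)
      (by simp) (by simp) (by simp) (by simp)).trans ?_
    simp only [Finset.univ_eq_empty, Finset.sum_empty]
    positivity
  · have hrank : 0 < T.rank := Nat.pos_of_ne_zero fun h => hT <| by
      obtain ⟨d, U, V, rfl, hUV, -⟩ := T.exists_rank_factorization
      have : IsEmpty (Fin T.rank) := h ▸ inferInstance
      rw [hUV]
      ext
      simp [Matrix.mul_apply]
    obtain ⟨i, j, hij⟩ : ∃ i j, T i j ≠ 0 := by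
      by_contra! h
      exact hT (Matrix.ext h)
    have hpos : 0 < entrySup T := (abs_pos.2 hij).trans_le (abs_le_entrySup T i j)
    obtain ⟨W, hW, hdiag, hTW⟩ := exists_correlation_matrix T hr hpos (abs_le_entrySup T) hrank
    rw [mul_assoc]
    exact nu1Mat_le_of_correlation hW hdiag (by positivity) hTW
end

section
/- Let n be a positive integer, Y a finite-dimensional real normed space with type-2 constant τ2(Y), and T : ℓ1^n → Y a linear map. Then π2(T*) ≤ ν1(T) ≤ √2 · τ2(Y) · π2(T*), where T* : Y* → ℓ∞^n is the adjoint map. -/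
open Real Set

/-- The 2-summing norm of a continuous linear map `S : F → G`. -/
noncomputable def pi2 {F G : Type*} [NormedAddCommGroup F] [NormedSpace ℝ F]
    [NormedAddCommGroup G] [NormedSpace ℝ G] (S : F →L[ℝ] G) : ℝ :=
  sInf {c | 0 ≤ c ∧ ∀ (k : ℕ) (x : Fin k → F),
    Real.sqrt (∑ i, ‖S (x i)‖^2)
      ≤ c * sSup {t | ∃ φ : F →L[ℝ] ℝ, ‖φ‖ ≤ 1 ∧ t = Real.sqrt (∑ i, (φ (x i))^2)}}

/-- The 1-nuclear norm of a continuous linear map `S : F → G`: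
`ν1(S) = inf {Σ_i ‖φ_i‖ ‖y_i‖ : S x = Σ_i φ_i(x) y_i}`. -/
noncomputable def nu1 {F G : Type*} [NormedAddCommGroup F] [NormedSpace ℝ F]
    [NormedAddCommGroup G] [NormedSpace ℝ G] (S : F →L[ℝ] G) : ℝ :=
  sInf {c | ∃ (s : ℕ) (φ : Fin s → (F →L[ℝ] ℝ)) (y : Fin s → G),
    (∀ x, S x = ∑ i, φ i x • y i) ∧ c = ∑ i, ‖φ i‖ * ‖y i‖}

/-- The type-2 constant of a normed space `Y`: the smallest `C` such that for every
finite sequence `(y_j)` in `Y`, `(E_ε ‖Σ_j ε_j y_j‖²)^{1/2} ≤ C (Σ_j ‖y_j‖²)^{1/2}`. -/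
noncomputable def type2Const (Y : Type*) [NormedAddCommGroup Y] [NormedSpace ℝ Y] : ℝ :=
  sInf {C | 0 ≤ C ∧ ∀ (k : ℕ) (y : Fin k → Y),
    Real.sqrt (((2:ℝ)^k)⁻¹ * ∑ ε : Fin k → Bool,
        ‖∑ j, (if ε j then (1:ℝ) else -1) • y j‖^2)
      ≤ C * Real.sqrt (∑ j, ‖y j‖^2)}

/-- the `i`-th standard basis vector of `ℓ1^n` -/
noncomputable def l1basis (n : ℕ) (i : Fin n) : PiLp 1 (fun _ : Fin n => ℝ) :=
  (WithLp.equiv 1 (Fin n → ℝ)).symm (Pi.single i 1)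


/-- The sign `±1` encoded by a Boolean. -/
noncomputable def boolSign (b : Bool) : ℝ := if b then 1 else -1

/-- The expectation of a function of `k` independent uniform signs. -/
noncomputable def signExp {k : ℕ} (f : (Fin k → Bool) → ℝ) : ℝ := ((2 : ℝ) ^ k)⁻¹ * ∑ ε, f ε

lemma boolSign_not (b : Bool) : boolSign (!b) = -boolSign b := by
  cases b <;> simp [boolSign]

section signExp

variable {k : ℕ}

lemma signExp_add (f g : (Fin k → Bool) → ℝ) :
    signExp (fun ε => f ε + g ε) = signExp f + signExp g := by
  simp [signExp, Finset.sum_add_distrib, mul_add]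

lemma signExp_const_mul (c : ℝ) (f : (Fin k → Bool) → ℝ) :
    signExp (fun ε => c * f ε) = c * signExp f := by
  simp only [signExp, ← Finset.mul_sum]
  ring

lemma signExp_sum {ι : Type*} (s : Finset ι) (f : ι → (Fin k → Bool) → ℝ) :
    signExp (fun ε => ∑ i ∈ s, f i ε) = ∑ i ∈ s, signExp (f i) := by
  simp only [signExp, ← Finset.mul_sum]
  rw [Finset.sum_comm]

lemma signExp_mono {f g : (Fin k → Bool) → ℝ} (h : ∀ ε, f ε ≤ g ε) : signExp f ≤ signExp g :=
  mul_le_mul_of_nonneg_left (Finset.sum_le_sum fun ε _ => h ε) (by positivity)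

lemma signExp_const (c : ℝ) : signExp (fun _ : Fin k → Bool => c) = c := by
  simp [signExp]

lemma signExp_nonneg {f : (Fin k → Bool) → ℝ} (h : ∀ ε, 0 ≤ f ε) : 0 ≤ signExp f :=
  mul_nonneg (by positivity) (Finset.sum_nonneg fun ε _ => h ε)

lemma signExp_comp_involutive (f : (Fin k → Bool) → ℝ) {σ : (Fin k → Bool) → (Fin k → Bool)}
    (hσ : Function.Involutive σ) : signExp (fun ε => f (σ ε)) = signExp f :=
  congrArg (((2 : ℝ) ^ k)⁻¹ * ·) (Equiv.sum_comp (hσ.toPerm σ) f)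

lemma signExp_sq_le (f : (Fin k → Bool) → ℝ) : signExp f ^ 2 ≤ signExp (fun ε => f ε ^ 2) := by
  have h : 0 ≤ signExp (fun ε => (f ε ^ 2 + (-2 * signExp f) * f ε) + signExp f ^ 2) :=
    signExp_nonneg fun ε => by nlinarith [sq_nonneg (f ε - signExp f)]
  rw [signExp_add, signExp_add, signExp_const_mul, signExp_const] at h
  nlinarith

lemma signExp_succ (f : (Fin (k + 1) → Bool) → ℝ) :
    signExp f = (signExp (fun ε => f (Fin.cons true ε)) +
      signExp (fun ε => f (Fin.cons false ε))) / 2 := by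
  simp only [signExp]
  rw [← Equiv.sum_comp (Fin.consEquiv fun _ => Bool) f, Fintype.sum_prod_type]
  simp only [Fintype.sum_bool, Fin.consEquiv, Equiv.coe_fn_mk, pow_succ]
  field_simp

/-- The assignment `ε` with its `i`-th sign reversed. -/
def flipSign (i : Fin k) (ε : Fin k → Bool) : Fin k → Bool := Function.update ε i (!ε i)

lemma flipSign_involutive (i : Fin k) : Function.Involutive (flipSign i) := fun ε => by
  simp [flipSign]

lemma flipSign_zero_cons (b : Bool) (ε : Fin k → Bool) :
    flipSign 0 (Fin.cons b ε : Fin (k + 1) → Bool) = Fin.cons (!b) ε := by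
  simp [flipSign]

lemma flipSign_succ_cons (b : Bool) (i : Fin k) (ε : Fin k → Bool) :
    flipSign i.succ (Fin.cons b ε : Fin (k + 1) → Bool) = Fin.cons b (flipSign i ε) := by
  simp [flipSign, Fin.cons_update]

/-- The Dirichlet energy of a function on the discrete cube. -/
noncomputable def cubeEnergy (f : (Fin k → Bool) → ℝ) : ℝ :=
  (∑ i, signExp (fun ε => (f ε - f (flipSign i ε)) ^ 2)) / 4

lemma cubeEnergy_succ (f : (Fin (k + 1) → Bool) → ℝ) :
    cubeEnergy f = signExp (fun ε => (f (Fin.cons true ε) - f (Fin.cons false ε)) ^ 2) / 4 +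
      (cubeEnergy (fun ε => f (Fin.cons true ε)) +
        cubeEnergy (fun ε => f (Fin.cons false ε))) / 2 := by
  have h : ∀ ε : Fin k → Bool, (f (Fin.cons false ε) - f (Fin.cons true ε)) ^ 2 =
      (f (Fin.cons true ε) - f (Fin.cons false ε)) ^ 2 := fun ε => sub_sq_comm _ _
  simp only [cubeEnergy, Fin.sum_univ_succ, signExp_succ (k := k), flipSign_zero_cons,
    flipSign_succ_cons, ← Finset.sum_div, Finset.sum_add_distrib, Bool.not_true, Bool.not_false, h]
  ring

lemma cubeEnergy_parallelogram (p q : (Fin k → Bool) → ℝ) :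
    cubeEnergy p + cubeEnergy q = 2 * cubeEnergy (fun ε => (p ε + q ε) / 2) +
      2 * cubeEnergy (fun ε => (p ε - q ε) / 2) := by
  simp only [cubeEnergy, ← add_div, ← mul_div_assoc, Finset.mul_sum, ← Finset.sum_add_distrib,
    ← signExp_add, ← signExp_const_mul]
  congr! 4
  ring

/-- The Poincaré inequality on the discrete cube. -/
lemma variance_le_cubeEnergy (f : (Fin k → Bool) → ℝ) :
    signExp (fun ε => f ε ^ 2) - signExp f ^ 2 ≤ cubeEnergy f := by
  induction k with
  | zero => simp [signExp, cubeEnergy]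
  | succ k ih =>
    set p := fun ε : Fin k → Bool => f (Fin.cons true ε) with hp
    set q := fun ε : Fin k → Bool => f (Fin.cons false ε) with hq
    rw [cubeEnergy_succ, signExp_succ f, signExp_succ]
    have hJ := signExp_sq_le (fun ε => p ε + (-1) * q ε)
    rw [signExp_add, signExp_const_mul] at hJ
    have h1 := ih p
    have h2 := ih q
    have h3 : signExp (fun ε => (p ε + -1 * q ε) ^ 2) = signExp (fun ε => (p ε - q ε) ^ 2) := by
      congr! 3; ring
    rw [h3] at hJ
    simp only [hp, hq] at *
    nlinarith

/-- A sharpening of the Poincaré inequality for functions without first-order Walsh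
coefficients. -/
lemma two_mul_variance_le_cubeEnergy (f : (Fin k → Bool) → ℝ) :
    2 * (signExp (fun ε => f ε ^ 2) - signExp f ^ 2) -
      ∑ i, signExp (fun ε => boolSign (ε i) * f ε) ^ 2 ≤ cubeEnergy f := by
  induction k with
  | zero => simp [signExp, cubeEnergy]
  | succ k ih =>
    set p := fun ε : Fin k → Bool => f (Fin.cons true ε) with hp
    set q := fun ε : Fin k → Bool => f (Fin.cons false ε) with hq
    set g := fun ε : Fin k → Bool => (p ε + q ε) / 2 with hg
    set h := fun ε : Fin k → Bool => (p ε - q ε) / 2 with hh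
    have hpE : p = fun ε => g ε + h ε := by funext ε; simp only [hg, hh]; ring
    have hqE : q = fun ε => g ε + (-1) * h ε := by funext ε; simp only [hg, hh]; ring
    have e1 : signExp f = signExp g := by
      rw [signExp_succ]
      change (signExp p + signExp q) / 2 = _
      rw [hpE, hqE, signExp_add, signExp_add, signExp_const_mul]; ring
    have e2 : signExp (fun ε => f ε ^ 2) =
        signExp (fun ε => g ε ^ 2) + signExp (fun ε => h ε ^ 2) := by
      rw [signExp_succ]
      change (signExp (fun ε => p ε ^ 2) + signExp (fun ε => q ε ^ 2)) / 2 = _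
      rw [← signExp_add, ← signExp_add, div_eq_inv_mul, ← signExp_const_mul]
      congr! 2 with ε
      simp only [hg, hh]; ring
    have e3 : signExp (fun ε => boolSign (ε 0) * f ε) = signExp h := by
      rw [signExp_succ]
      simp only [Fin.cons_zero]
      rw [← signExp_add, div_eq_inv_mul, ← signExp_const_mul]
      congr! 2 with ε
      simp only [hh, hp, hq, boolSign]; simp; ring
    have e4 : ∀ i : Fin k, signExp (fun ε => boolSign (ε i.succ) * f ε) =
        signExp (fun ε => boolSign (ε i) * g ε) := by
      intro i
      rw [signExp_succ]
      simp only [Fin.cons_succ]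
      rw [← signExp_add, div_eq_inv_mul, ← signExp_const_mul]
      congr! 2 with ε
      simp only [hg, hp, hq]; ring
    have e5 : cubeEnergy f = signExp (fun ε => h ε ^ 2) + cubeEnergy g + cubeEnergy h := by
      rw [cubeEnergy_succ]
      change signExp (fun ε => (p ε - q ε) ^ 2) / 4 + (cubeEnergy p + cubeEnergy q) / 2 = _
      rw [cubeEnergy_parallelogram, div_eq_inv_mul, ← signExp_const_mul]
      have : (fun ε => (4 : ℝ)⁻¹ * (p ε - q ε) ^ 2) = fun ε => h ε ^ 2 := by
        funext ε; simp only [hh]; ring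
      rw [this]; ring
    rw [Fin.sum_univ_succ, e1, e2, e3, e5]
    simp only [e4]
    have h1 := ih g
    have h2 := variance_le_cubeEnergy h
    linarith

/-- The Rademacher sum with coefficients `a`. -/
noncomputable def radSum (a : Fin k → ℝ) (ε : Fin k → Bool) : ℝ := ∑ j, boolSign (ε j) * a j

lemma signExp_radSum_sq (a : Fin k → ℝ) : signExp (fun ε => radSum a ε ^ 2) = ∑ j, a j ^ 2 := by
  induction k with
  | zero => simp [signExp, radSum]
  | succ k ih =>
    rw [signExp_succ, ← signExp_add, div_eq_inv_mul, ← signExp_const_mul, Fin.sum_univ_succ,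
      ← ih, add_comm (a 0 ^ 2)]
    conv_rhs => rw [← signExp_const (k := k) (a 0 ^ 2), ← signExp_add]
    congr! 2 with ε
    simp only [radSum, Fin.sum_univ_succ, Fin.cons_zero, Fin.cons_succ, boolSign]
    simp
    ring

lemma radSum_flipSign (a : Fin k → ℝ) (i : Fin k) (ε : Fin k → Bool) :
    radSum a (flipSign i ε) = radSum a ε - 2 * (boolSign (ε i) * a i) := by
  have h : ∀ j, boolSign (flipSign i ε j) * a j =
      boolSign (ε j) * a j - if j = i then 2 * (boolSign (ε i) * a i) else 0 := by
    intro j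
    by_cases hj : j = i
    · subst hj
      simp only [flipSign, Function.update_self, boolSign_not, if_true]
      ring
    · simp [flipSign, hj]
  simp only [radSum, h, Finset.sum_sub_distrib]
  simp

/-- Khinchine's inequality with Szarek's optimal constant, after Latała and Oleszkiewicz. -/
lemma sum_sq_le_two_mul_signExp_abs_sq (a : Fin k → ℝ) :
    ∑ j, a j ^ 2 ≤ 2 * signExp (fun ε => |radSum a ε|) ^ 2 := by
  set f := fun ε => |radSum a ε| with hf
  have hflip : ∀ ε, ((k : ℝ) - 2) * f ε ≤ ∑ i, f (flipSign i ε) := by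
    intro ε
    have h1 : ∑ i, radSum a (flipSign i ε) = ((k : ℝ) - 2) * radSum a ε := by
      simp only [radSum_flipSign, Finset.sum_sub_distrib, ← Finset.mul_sum]
      simp [radSum]; ring
    calc ((k : ℝ) - 2) * f ε ≤ |(k : ℝ) - 2| * |radSum a ε| :=
          mul_le_mul_of_nonneg_right (le_abs_self _) (abs_nonneg _)
      _ = |∑ i, radSum a (flipSign i ε)| := by rw [h1, abs_mul]
      _ ≤ _ := Finset.abs_sum_le_sum_abs _ _
  have hE : cubeEnergy f ≤ signExp (fun ε => f ε ^ 2) := by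
    have h1 : ∀ i : Fin k, signExp (fun ε => (f ε - f (flipSign i ε)) ^ 2) =
        2 * signExp (fun ε => f ε ^ 2) + (-2) * signExp (fun ε => f ε * f (flipSign i ε)) := by
      intro i
      have h2 := signExp_comp_involutive (fun ε => f ε ^ 2) (flipSign_involutive i)
      have h3 : signExp (fun ε => (f ε - f (flipSign i ε)) ^ 2) =
          signExp (fun ε => (f ε ^ 2 + f (flipSign i ε) ^ 2) +
            (-2) * (f ε * f (flipSign i ε))) := by
        congr! 2; ring
      rw [h3, signExp_add, signExp_add, signExp_const_mul, h2]
      ring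
    have h4 : ((k : ℝ) - 2) * signExp (fun ε => f ε ^ 2) ≤
        ∑ i, signExp (fun ε => f ε * f (flipSign i ε)) := by
      rw [← signExp_sum, ← signExp_const_mul]
      refine signExp_mono fun ε => ?_
      rw [← Finset.mul_sum]
      nlinarith [mul_le_mul_of_nonneg_left (hflip ε) (abs_nonneg (radSum a ε))]
    simp only [cubeEnergy, h1, Finset.sum_add_distrib, ← Finset.mul_sum]
    simp only [Finset.sum_const, Finset.card_univ, Fintype.card_fin, nsmul_eq_mul]
    linarith
  have hodd : ∀ i, signExp (fun ε => boolSign (ε i) * f ε) = 0 := by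
    intro i
    have h1 := signExp_comp_involutive (fun ε => boolSign (ε i) * f ε)
      (σ := fun ε j => !ε j) (fun ε => by simp)
    have h2 : ∀ ε : Fin k → Bool, f (fun j => !ε j) = f ε := by
      intro ε
      simp [hf, radSum, boolSign_not]
    simp only [h2, boolSign_not] at h1
    have h3 := signExp_const_mul (-1) (fun ε => boolSign (ε i) * f ε)
    simp only [← mul_assoc, neg_one_mul] at h3
    simp only [neg_mul] at h1 h3
    linarith
  have hP := two_mul_variance_le_cubeEnergy f
  simp only [hodd] at hP
  have hS : signExp (fun ε => f ε ^ 2) = ∑ j, a j ^ 2 := by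
    rw [← signExp_radSum_sq]
    simp [hf]
  rw [← hS]
  simp at hP
  linarith

end signExp

section TypeTwo

variable {Y : Type*} [NormedAddCommGroup Y] [NormedSpace ℝ Y]

/-- `C` is an admissible constant in the definition of type 2. -/
def HasTypeTwo (Y : Type*) [NormedAddCommGroup Y] [NormedSpace ℝ Y] (C : ℝ) : Prop :=
  0 ≤ C ∧ ∀ (k : ℕ) (y : Fin k → Y),
    √(signExp fun ε => ‖∑ j, boolSign (ε j) • y j‖ ^ 2) ≤ C * √(∑ j, ‖y j‖ ^ 2)

lemma radSum_map_eq {k : ℕ} (s : Y →L[ℝ] ℝ) (y : Fin k → Y) (ε : Fin k → Bool) :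
    radSum (fun j => s (y j)) ε = s (∑ j, boolSign (ε j) • y j) := by
  simp [radSum]

/-- Every finite-dimensional space has type 2. -/
lemma exists_hasTypeTwo [FiniteDimensional ℝ Y] : ∃ C, HasTypeTwo Y C := by
  let b := Module.finBasis ℝ Y
  let c : Fin (Module.finrank ℝ Y) → (Y →L[ℝ] ℝ) := fun l => (b.coord l).toContinuousLinearMap
  have hc : ∀ y, y = ∑ l, c l y • b l := fun y => (b.sum_repr y).symm
  set M : ℝ := (∑ l, ‖b l‖ ^ 2) * ∑ l, ‖c l‖ ^ 2 with hM
  have hM0 : 0 ≤ M := by positivity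
  refine ⟨√M, Real.sqrt_nonneg _, fun k y => ?_⟩
  rw [← Real.sqrt_mul hM0]
  refine Real.sqrt_le_sqrt ?_
  have h1 : ∀ z : Y, ‖z‖ ^ 2 ≤ (∑ l, ‖b l‖ ^ 2) * ∑ l, c l z ^ 2 := by
    intro z
    have h2 : ‖z‖ ≤ ∑ l, ‖b l‖ * |c l z| := by
      conv_lhs => rw [hc z]
      refine (norm_sum_le _ _).trans_eq (Finset.sum_congr rfl fun l _ => ?_)
      rw [norm_smul, Real.norm_eq_abs, mul_comm]
    calc ‖z‖ ^ 2 ≤ (∑ l, ‖b l‖ * |c l z|) ^ 2 := by gcongr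
      _ ≤ (∑ l, ‖b l‖ ^ 2) * ∑ l, |c l z| ^ 2 := Finset.sum_mul_sq_le_sq_mul_sq _ _ _
      _ = _ := by simp only [sq_abs]
  calc signExp (fun ε => ‖∑ j, boolSign (ε j) • y j‖ ^ 2)
      ≤ signExp (fun ε => (∑ l, ‖b l‖ ^ 2) * ∑ l, radSum (fun j => c l (y j)) ε ^ 2) := by
        refine signExp_mono fun ε => ?_
        simp only [radSum_map_eq]
        exact h1 _
    _ = (∑ l, ‖b l‖ ^ 2) * ∑ l, ∑ j, c l (y j) ^ 2 := by
        rw [signExp_const_mul, signExp_sum]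
        simp only [signExp_radSum_sq]
    _ ≤ (∑ l, ‖b l‖ ^ 2) * ∑ l, ∑ j, ‖c l‖ ^ 2 * ‖y j‖ ^ 2 := by
        gcongr with l _ j _
        rw [← mul_pow, ← sq_abs]
        gcongr
        exact (c l).le_opNorm (y j)
    _ = M * ∑ j, ‖y j‖ ^ 2 := by
        rw [hM, mul_assoc, Finset.sum_mul_sum _ _ fun l => ‖c l‖ ^ 2]

/-- An operator from a type 2 space to `ℓ₁`, given by its coordinates `s i`, satisfies a square
function estimate. -/
lemma HasTypeTwo.sum_sqrt_le {C : ℝ} (hC : HasTypeTwo Y C) {n : ℕ} (s : Fin n → (Y →L[ℝ] ℝ))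
    (hs : ∀ y, ∑ i, |s i y| ≤ ‖y‖) {k : ℕ} (y : Fin k → Y) :
    ∑ i, √(∑ j, s i (y j) ^ 2) ≤ √2 * C * √(∑ j, ‖y j‖ ^ 2) := by
  calc ∑ i, √(∑ j, s i (y j) ^ 2)
      ≤ ∑ i, √2 * signExp (fun ε => |radSum (fun j => s i (y j)) ε|) := by
        refine Finset.sum_le_sum fun i _ => ?_
        refine (Real.sqrt_le_sqrt (sum_sq_le_two_mul_signExp_abs_sq _)).trans_eq ?_
        rw [Real.sqrt_mul (by norm_num), Real.sqrt_sq (signExp_nonneg fun ε => abs_nonneg _)]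
    _ = √2 * signExp (fun ε => ∑ i, |s i (∑ j, boolSign (ε j) • y j)|) := by
        rw [signExp_sum, Finset.mul_sum]
        simp only [radSum_map_eq]
    _ ≤ √2 * signExp (fun ε => ‖∑ j, boolSign (ε j) • y j‖) := by
        gcongr
        exact signExp_mono fun ε => hs _
    _ ≤ √2 * √(signExp (fun ε => ‖∑ j, boolSign (ε j) • y j‖ ^ 2)) := by
        gcongr
        exact Real.le_sqrt_of_sq_le (signExp_sq_le _)
    _ ≤ √2 * (C * √(∑ j, ‖y j‖ ^ 2)) := by
        gcongr
        exact hC.2 k y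
    _ = _ := by ring

end TypeTwo

lemma sqrt_add_le {x y : ℝ} (hx : 0 ≤ x) (hy : 0 ≤ y) : √(x + y) ≤ √x + √y := by
  rw [Real.sqrt_le_left (by positivity), add_sq, Real.sq_sqrt hx, Real.sq_sqrt hy]
  nlinarith [mul_nonneg (Real.sqrt_nonneg x) (Real.sqrt_nonneg y)]

/-- On a compact convex set in the positive orthant on which `∑ √aᵢ ≤ K`, almost optimal weights
linearize the square function. -/
lemma exists_weights_of_sum_sqrt_le {n : ℕ} {A : Set (Fin n → ℝ)} (hcomp : IsCompact A)
    (hconv : Convex ℝ A) (hne : A.Nonempty) (hnn : ∀ a ∈ A, ∀ i, 0 ≤ a i) {K δ : ℝ} (hδ : 0 < δ)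
    (hK : ∀ a ∈ A, ∑ i, √(a i) ≤ K) :
    ∃ μ : Fin n → ℝ, (∀ i, 0 < μ i) ∧ ∑ i, μ i ≤ K + n * √δ ∧
      ∀ a ∈ A, ∑ i, a i / μ i ≤ K + n * √δ := by
  have hcont : Continuous fun a : Fin n → ℝ => ∑ i, √(a i + δ) := by fun_prop
  obtain ⟨m, hm, hmax⟩ := hcomp.exists_isMaxOn hne hcont.continuousOn
  have hpos : ∀ i, 0 < m i + δ := fun i => add_pos_of_nonneg_of_pos (hnn m hm i) hδ
  have hμ : ∀ i, 0 < √(m i + δ) := fun i => Real.sqrt_pos.2 (hpos i)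
  have hsum : ∑ i, √(m i + δ) ≤ K + n * √δ := by
    calc ∑ i, √(m i + δ) ≤ ∑ i, (√(m i) + √δ) :=
          Finset.sum_le_sum fun i _ => sqrt_add_le (hnn m hm i) hδ.le
      _ = ∑ i, √(m i) + n * √δ := by simp [Finset.sum_add_distrib]
      _ ≤ _ := by gcongr; exact hK m hm
  refine ⟨fun i => √(m i + δ), hμ, hsum, fun a ha => ?_⟩
  have hderiv : HasFDerivAt (fun a : Fin n → ℝ => ∑ i, √(a i + δ))
      (∑ i, (1 / (2 * √(m i + δ))) • (ContinuousLinearMap.proj i : (Fin n → ℝ) →L[ℝ] ℝ)) m := by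
    refine HasFDerivAt.fun_sum fun i _ => ?_
    have h1 : HasFDerivAt (fun a : Fin n → ℝ => a i + δ)
        (ContinuousLinearMap.proj i : (Fin n → ℝ) →L[ℝ] ℝ) m :=
      (hasFDerivAt_apply i m).add_const δ
    exact h1.sqrt (hpos i).ne'
  have hle := hmax.localize.hasFDerivWithinAt_nonpos hderiv.hasFDerivWithinAt
    (sub_mem_posTangentConeAt_of_segment_subset (hconv.segment_subset hm ha))
  simp only [sum_apply, smul_apply,
    ContinuousLinearMap.proj_apply, Pi.sub_apply, smul_eq_mul] at hle
  have h2 : ∑ i, a i / √(m i + δ) - ∑ i, m i / √(m i + δ) =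
      2 * ∑ i, 1 / (2 * √(m i + δ)) * (a i - m i) := by
    rw [← Finset.sum_sub_distrib, Finset.mul_sum]
    refine Finset.sum_congr rfl fun i _ => ?_
    have := (hμ i).ne'
    field_simp
  have h3 : ∑ i, m i / √(m i + δ) ≤ ∑ i, √(m i + δ) := by
    refine Finset.sum_le_sum fun i _ => ?_
    rw [div_le_iff₀ (hμ i), Real.mul_self_sqrt (hpos i).le]
    linarith
  linarith

/-- A form of Maurey's factorization through a weighted `ℓ₂`. -/
lemma exists_weights_of_square_function_le {Y : Type*} [NormedAddCommGroup Y] [NormedSpace ℝ Y]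
    {n : ℕ} (s : Fin n → (Y →L[ℝ] ℝ)) {K δ : ℝ} (hδ : 0 < δ)
    (hK : ∀ (k : ℕ) (y : Fin k → Y), ∑ i, √(∑ j, s i (y j) ^ 2) ≤ K * √(∑ j, ‖y j‖ ^ 2))
    (hK0 : 0 ≤ K) :
    ∃ μ : Fin n → ℝ, (∀ i, 0 < μ i) ∧ ∑ i, μ i ≤ K + n * √δ ∧
      ∀ y : Y, ‖y‖ ≤ 1 → ∑ i, s i y ^ 2 / μ i ≤ K + n * √δ := by
  let A : Set (Fin n → ℝ) :=
    {a | ∃ (k : ℕ) (y : Fin k → Y), ∑ j, ‖y j‖ ^ 2 ≤ 1 ∧ a = fun i => ∑ j, s i (y j) ^ 2}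
  have hAconv : Convex ℝ A := by
    rintro _ ⟨k, y, hy, rfl⟩ _ ⟨l, z, hz, rfl⟩ p q hp hq hpq
    refine ⟨k + l, Fin.append (fun j => √p • y j) (fun j => √q • z j), ?_, ?_⟩
    · simp only [Fin.sum_univ_add, Fin.append_left, Fin.append_right, norm_smul, mul_pow,
        Real.norm_eq_abs, sq_abs, Real.sq_sqrt hp, Real.sq_sqrt hq, ← Finset.mul_sum]
      nlinarith
    · funext i
      simp [Fin.sum_univ_add, mul_pow, Real.sq_sqrt hp, Real.sq_sqrt hq, ← Finset.mul_sum]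
  have hAnn : A ⊆ {a | ∀ i, 0 ≤ a i} := by
    rintro _ ⟨k, y, -, rfl⟩ i
    positivity
  have hAK : A ⊆ {a | ∑ i, √(a i) ≤ K} := by
    rintro _ ⟨k, y, hy, rfl⟩
    refine (hK k y).trans (mul_le_of_le_one_right hK0 ?_)
    exact Real.sqrt_le_one.2 hy
  have hAbdd : Bornology.IsBounded A := by
    refine (Metric.isBounded_Icc (0 : Fin n → ℝ) (fun _ => K ^ 2)).subset fun a ha => ?_
    refine ⟨fun i => hAnn ha i, fun i => ?_⟩
    have h1 : √(a i) ≤ K :=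
      (Finset.single_le_sum (f := fun i => √(a i)) (fun j _ => Real.sqrt_nonneg _)
        (Finset.mem_univ i)).trans (hAK ha)
    exact (Real.sqrt_le_left hK0).1 h1
  have hcl1 : closure A ⊆ {a | ∀ i, 0 ≤ a i} := by
    refine closure_minimal hAnn ?_
    simp only [ofPred_forall]
    exact isClosed_iInter fun i => isClosed_le continuous_const (continuous_apply i)
  have hcl2 : closure A ⊆ {a | ∑ i, √(a i) ≤ K} :=
    closure_minimal hAK (isClosed_le (by fun_prop) continuous_const)
  have hmem : ∀ y : Y, ‖y‖ ≤ 1 → (fun i => s i y ^ 2) ∈ A := fun y hy =>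
    ⟨1, fun _ => y, by simpa using hy, by simp⟩
  obtain ⟨μ, h1, h2, h3⟩ := exists_weights_of_sum_sqrt_le hAbdd.isCompact_closure hAconv.closure
    ⟨_, subset_closure (hmem 0 (by simp))⟩ hcl1 hδ hcl2
  exact ⟨μ, h1, h2, fun y hy => h3 _ (subset_closure (hmem y hy))⟩

section Nuclear

variable {F G : Type*} [NormedAddCommGroup F] [NormedSpace ℝ F]
  [NormedAddCommGroup G] [NormedSpace ℝ G]

/-- The values `∑ ‖φᵢ‖ ‖yᵢ‖` over all finite nuclear representations of `S`. -/
def nuclearValues (S : F →L[ℝ] G) : Set ℝ :=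
  {c | ∃ (s : ℕ) (φ : Fin s → (F →L[ℝ] ℝ)) (y : Fin s → G),
    (∀ x, S x = ∑ i, φ i x • y i) ∧ c = ∑ i, ‖φ i‖ * ‖y i‖}

lemma nu1_eq_sInf (S : F →L[ℝ] G) : nu1 S = sInf (nuclearValues S) := rfl

lemma nuclearValues_nonneg {S : F →L[ℝ] G} {c : ℝ} (hc : c ∈ nuclearValues S) : 0 ≤ c := by
  obtain ⟨s, φ, y, -, rfl⟩ := hc
  positivity

lemma nuclearValues_bddBelow (S : F →L[ℝ] G) : BddBelow (nuclearValues S) :=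
  ⟨0, fun _ => nuclearValues_nonneg⟩

lemma nu1_nonneg (S : F →L[ℝ] G) : 0 ≤ nu1 S :=
  Real.sInf_nonneg fun _ => nuclearValues_nonneg

lemma nuclearValues_nonempty [FiniteDimensional ℝ F] (S : F →L[ℝ] G) :
    (nuclearValues S).Nonempty := by
  let b := Module.finBasis ℝ F
  refine ⟨_, _, fun l => (b.coord l).toContinuousLinearMap, fun l => S (b l), fun x => ?_, rfl⟩
  conv_lhs => rw [← b.sum_repr x, map_sum]
  simp only [map_smul]
  rfl

lemma nu1_add_le [FiniteDimensional ℝ F] (S R : F →L[ℝ] G) : nu1 (S + R) ≤ nu1 S + nu1 R := by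
  rw [nu1_eq_sInf S, nu1_eq_sInf R, ← csInf_add (nuclearValues_nonempty S)
    (nuclearValues_bddBelow S) (nuclearValues_nonempty R) (nuclearValues_bddBelow R)]
  refine le_csInf ((nuclearValues_nonempty S).add (nuclearValues_nonempty R)) ?_
  rintro _ ⟨_, ⟨k, φ, y, h, rfl⟩, _, ⟨l, ψ, z, h', rfl⟩, rfl⟩
  refine csInf_le (nuclearValues_bddBelow _)
    ⟨k + l, Fin.append φ ψ, Fin.append y z, fun x => ?_, ?_⟩
  · simp [Fin.sum_univ_add, h x, h' x]
  · simp [Fin.sum_univ_add]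

lemma nu1_smul_le [FiniteDimensional ℝ F] (c : ℝ) (S : F →L[ℝ] G) :
    nu1 (c • S) ≤ |c| * nu1 S := by
  rw [nu1_eq_sInf S, ← smul_eq_mul, ← Real.sInf_smul_of_nonneg (abs_nonneg c)]
  refine le_csInf ((nuclearValues_nonempty S).smul_set) ?_
  rintro _ ⟨_, ⟨k, φ, y, h, rfl⟩, rfl⟩
  refine csInf_le (nuclearValues_bddBelow _) ⟨k, fun i => c • φ i, y, fun x => ?_, ?_⟩
  · simp [h x, Finset.smul_sum, mul_smul]
  · simp [Finset.mul_sum, norm_smul, mul_assoc]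

/-- The nuclear norm as a seminorm. -/
noncomputable def nu1Seminorm [FiniteDimensional ℝ F] : Seminorm ℝ (F →L[ℝ] G) :=
  Seminorm.ofSMulLE nu1
    (le_antisymm (by simpa using nu1_smul_le (0 : ℝ) (0 : F →L[ℝ] G)) (nu1_nonneg _))
    nu1_add_le nu1_smul_le

lemma nu1_smulRight_le (φ : F →L[ℝ] ℝ) (y : G) : nu1 (φ.smulRight y) ≤ ‖φ‖ * ‖y‖ :=
  csInf_le (nuclearValues_bddBelow _) ⟨1, fun _ => φ, fun _ => y, by simp, by simp⟩

/-- The nuclear norm is attained by a functional that it dominates. -/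
lemma exists_dual_eq_nu1 [FiniteDimensional ℝ F] (S : F →L[ℝ] G) :
    ∃ f : (F →L[ℝ] G) →ₗ[ℝ] ℝ, f S = nu1 S ∧ ∀ R, |f R| ≤ nu1 R := by
  have h0 : ∀ c : ℝ, c • S = 0 → (RingHom.id ℝ) c • nu1 S = 0 := by
    intro c hc
    rcases smul_eq_zero.1 hc with rfl | rfl
    · simp
    · exact (congrArg (c • ·) (map_zero (nu1Seminorm (F := F) (G := G)))).trans (smul_zero c)
  let f₀ : (F →L[ℝ] G) →ₗ.[ℝ] ℝ := LinearPMap.mkSpanSingleton' S (nu1 S) h0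
  obtain ⟨f, hf, hle⟩ := Module.Dual.exists_extension_of_le_seminorm_real f₀.domain f₀.toFun
    (p := nu1Seminorm) (by
      rintro ⟨x, hx⟩
      obtain ⟨c, rfl⟩ := Submodule.mem_span_singleton.1 hx
      have h1 : f₀.toFun ⟨c • S, hx⟩ = c * nu1 S := LinearPMap.mkSpanSingleton'_apply _ _ h0 _ _
      rw [h1, map_smul_eq_mul]
      exact mul_le_mul_of_nonneg_right (le_abs_self c) (nu1_nonneg S))
  refine ⟨f, ?_, hle⟩
  have hS : S ∈ f₀.domain := Submodule.mem_span_singleton_self S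
  exact (hf ⟨S, hS⟩).trans (LinearPMap.mkSpanSingleton'_apply_self _ _ h0 _)

end Nuclear

section TwoSumming

variable {F G : Type*} [NormedAddCommGroup F] [NormedSpace ℝ F]
  [NormedAddCommGroup G] [NormedSpace ℝ G]

/-- The weak `ℓ₂` norm of a finite family. -/
noncomputable def weakTwoNorm {k : ℕ} (x : Fin k → F) : ℝ :=
  sSup {t | ∃ φ : F →L[ℝ] ℝ, ‖φ‖ ≤ 1 ∧ t = √(∑ i, (φ (x i)) ^ 2)}

/-- `c` is an admissible constant in the definition of the 2-summing norm. -/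
def IsTwoSummingBound (S : F →L[ℝ] G) (c : ℝ) : Prop :=
  0 ≤ c ∧ ∀ (k : ℕ) (x : Fin k → F), √(∑ i, ‖S (x i)‖ ^ 2) ≤ c * weakTwoNorm x

lemma sqrt_sum_sq_le_weakTwoNorm {k : ℕ} (x : Fin k → F) (φ : F →L[ℝ] ℝ) :
    √(∑ i, φ (x i) ^ 2) ≤ ‖φ‖ * weakTwoNorm x := by
  have hb : BddAbove {t | ∃ φ : F →L[ℝ] ℝ, ‖φ‖ ≤ 1 ∧ t = √(∑ i, (φ (x i)) ^ 2)} := by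
    refine ⟨√(∑ i, ‖x i‖ ^ 2), ?_⟩
    rintro _ ⟨ψ, hψ, rfl⟩
    refine Real.sqrt_le_sqrt (Finset.sum_le_sum fun i _ => ?_)
    rw [← sq_abs]
    gcongr
    exact (ψ.le_opNorm (x i)).trans (mul_le_of_le_one_left (norm_nonneg _) hψ)
  rcases eq_or_ne φ 0 with rfl | hφ
  · simp
  have hφ_pos : 0 < ‖φ‖ := norm_pos_iff.2 hφ
  have h1 : √(∑ i, ((‖φ‖⁻¹ • φ) (x i)) ^ 2) ≤ weakTwoNorm x :=
    le_csSup hb ⟨_, by rw [norm_smul, norm_inv, norm_norm, inv_mul_cancel₀ hφ_pos.ne'], rfl⟩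
  have h2 : √(∑ i, ((‖φ‖⁻¹ • φ) (x i)) ^ 2) = ‖φ‖⁻¹ * √(∑ i, φ (x i) ^ 2) := by
    simp only [smul_apply, smul_eq_mul, mul_pow, ← Finset.mul_sum]
    rw [Real.sqrt_mul (by positivity), Real.sqrt_sq (by positivity)]
  rwa [h2, inv_mul_le_iff₀ hφ_pos] at h1

/-- In the dual of a finite-dimensional space the weak `ℓ₂` norm is tested on vectors. -/
lemma weakTwoNorm_dual_le {Y : Type*} [NormedAddCommGroup Y] [NormedSpace ℝ Y]
    [FiniteDimensional ℝ Y] {k : ℕ} (ψ : Fin k → (Y →L[ℝ] ℝ)) {M : ℝ}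
    (hM : ∀ y : Y, ‖y‖ ≤ 1 → √(∑ i, ψ i y ^ 2) ≤ M) : weakTwoNorm ψ ≤ M := by
  have hfin : ∀ (V : Type _) [NormedAddCommGroup V] [NormedSpace ℝ V] [FiniteDimensional ℝ V],
      Module.finrank ℝ (V →L[ℝ] ℝ) = Module.finrank ℝ V := fun V _ _ _ =>
    (LinearMap.toContinuousLinearMap (𝕜 := ℝ) (E := V) (F' := ℝ)).finrank_eq.symm.trans
      Subspace.dual_finrank_eq
  let J := NormedSpace.inclusionInDoubleDualLi (E := Y) ℝ
  have hsurj : Function.Surjective J :=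
    (LinearMap.injective_iff_surjective_of_finrank_eq_finrank (f := J.toLinearMap)
      (by rw [hfin (Y →L[ℝ] ℝ), hfin Y])).1 J.injective
  refine csSup_le ⟨_, 0, by simp, rfl⟩ ?_
  rintro _ ⟨φ, hφ, rfl⟩
  obtain ⟨y, rfl⟩ := hsurj φ
  exact hM y (by rwa [J.norm_map] at hφ)

/-- Minkowski's inequality in `ℓ₂`. -/
lemma sqrt_sum_sum_sq_le {ι κ : Type*} [Fintype ι] [Fintype κ] (f : ι → κ → ℝ) :
    √(∑ j, (∑ i, f i j) ^ 2) ≤ ∑ i, √(∑ j, f i j ^ 2) := by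
  have h := norm_sum_le Finset.univ fun i => (WithLp.toLp 2 (f i) : EuclideanSpace ℝ κ)
  simpa [EuclideanSpace.norm_eq] using h

end TwoSumming

section Adjoint

variable {n : ℕ} {Y : Type*} [NormedAddCommGroup Y] [NormedSpace ℝ Y]
  {T : PiLp 1 (fun _ : Fin n => ℝ) →L[ℝ] Y}
  {Tstar : (Y →L[ℝ] ℝ) →L[ℝ] PiLp ⊤ (fun _ : Fin n => ℝ)}

lemma norm_l1basis (i : Fin n) : ‖l1basis n i‖ = 1 := by
  simp [l1basis]

lemma isTwoSummingBound_of_mem_nuclearValues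
    (hTstar : ∀ (ψ : Y →L[ℝ] ℝ) (i : Fin n),
      (WithLp.equiv ⊤ (Fin n → ℝ)) (Tstar ψ) i = ψ (T (l1basis n i)))
    {c : ℝ} (hc : c ∈ nuclearValues T) : IsTwoSummingBound Tstar c := by
  refine ⟨nuclearValues_nonneg hc, fun k ψ => ?_⟩
  obtain ⟨s, φ, y, h, rfl⟩ := hc
  have hnorm : ∀ χ : Y →L[ℝ] ℝ, ‖Tstar χ‖ ≤ ∑ i, ‖φ i‖ * |χ (y i)| := by
    intro χ
    rw [← PiLp.norm_ofLp, pi_norm_le_iff_of_nonneg (by positivity)]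
    intro l
    have h1 : WithLp.ofLp (Tstar χ) l = ∑ i, φ i (l1basis n l) * χ (y i) := by
      refine (hTstar χ l).trans ?_
      simp [h]
    rw [h1]
    refine (norm_sum_le _ _).trans (Finset.sum_le_sum fun i _ => ?_)
    rw [norm_mul, Real.norm_eq_abs (χ (y i))]
    gcongr
    simpa [norm_l1basis] using (φ i).le_opNorm (l1basis n l)
  calc √(∑ j, ‖Tstar (ψ j)‖ ^ 2)
      ≤ √(∑ j, (∑ i, ‖φ i‖ * |ψ j (y i)|) ^ 2) := by
        gcongr with j
        exact hnorm (ψ j)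
    _ ≤ ∑ i, √(∑ j, (‖φ i‖ * |ψ j (y i)|) ^ 2) :=
        sqrt_sum_sum_sq_le fun i j => ‖φ i‖ * |ψ j (y i)|
    _ ≤ ∑ i, ‖φ i‖ * (‖y i‖ * weakTwoNorm ψ) := by
        refine Finset.sum_le_sum fun i _ => ?_
        simp only [mul_pow, sq_abs, ← Finset.mul_sum]
        rw [Real.sqrt_mul (by positivity), Real.sqrt_sq (norm_nonneg _)]
        gcongr
        refine (sqrt_sum_sq_le_weakTwoNorm ψ
          (NormedSpace.inclusionInDoubleDualLi (E := Y) ℝ (y i))).trans_eq ?_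
        rw [LinearIsometry.norm_map]
    _ = _ := by
        rw [Finset.sum_mul]
        exact Finset.sum_congr rfl fun i _ => by ring

/-- Trace duality: the nuclear norm of an operator on `ℓ₁ⁿ` is attained by a contraction
into `ℓ₁ⁿ`. -/
lemma exists_coordinates_sum_eq_nu1 [FiniteDimensional ℝ Y]
    (T : PiLp 1 (fun _ : Fin n => ℝ) →L[ℝ] Y) :
    ∃ s : Fin n → (Y →L[ℝ] ℝ), (∀ y, ∑ i, |s i y| ≤ ‖y‖) ∧
      nu1 T = ∑ i, s i (T (l1basis n i)) := by
  obtain ⟨f, hf, hle⟩ := exists_dual_eq_nu1 T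
  let e : Fin n → (PiLp 1 (fun _ : Fin n => ℝ) →L[ℝ] ℝ) := fun i => PiLp.proj 1 (fun _ => ℝ) i
  have hT : T = ∑ i, (e i).smulRight (T (l1basis n i)) := by
    ext x
    have hx : x = ∑ i, x i • l1basis n i := by
      ext j
      simp [l1basis, Pi.single_apply]
    conv_lhs => rw [hx]
    simp [e, sum_apply]
  let s : Fin n → (Y →L[ℝ] ℝ) := fun i => LinearMap.toContinuousLinearMap
    { toFun := fun y => f ((e i).smulRight y)
      map_add' := fun y z => by
        rw [← map_add]; congr 1; ext x; simp
      map_smul' := fun c y => by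
        rw [RingHom.id_apply, ← map_smul]; congr 1; ext x; simp [smul_comm c] }
  refine ⟨s, fun y => ?_, ?_⟩
  · let σ : Fin n → ℝ := fun i => SignType.sign (s i y)
    have hσ : ∀ i, |σ i| ≤ 1 := by
      intro i
      simp only [σ]
      rcases SignType.sign (s i y) with _ | _ | _ <;> simp
    have h1 : ∑ i, |s i y| = f ((∑ i, σ i • e i).smulRight y) := by
      have h2 : (∑ i, σ i • e i).smulRight y = ∑ i, σ i • (e i).smulRight y := by
        ext x
        simp [sum_apply, Finset.sum_smul, mul_smul]
      rw [h2, map_sum]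
      refine Finset.sum_congr rfl fun i _ => ?_
      rw [map_smul, smul_eq_mul]
      exact (sign_mul_self (s i y)).symm
    have h3 : ‖∑ i, σ i • e i‖ ≤ 1 := by
      refine ContinuousLinearMap.opNorm_le_bound _ zero_le_one fun x => ?_
      rw [one_mul, PiLp.norm_eq_of_L1, sum_apply]
      refine (norm_sum_le _ _).trans (Finset.sum_le_sum fun i _ => ?_)
      simp only [smul_apply, norm_smul]
      exact mul_le_of_le_one_left (norm_nonneg _) (hσ i)
    rw [h1]
    calc f ((∑ i, σ i • e i).smulRight y) ≤ nu1 ((∑ i, σ i • e i).smulRight y) :=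
          (le_abs_self _).trans (hle _)
      _ ≤ ‖∑ i, σ i • e i‖ * ‖y‖ := nu1_smulRight_le _ _
      _ ≤ ‖y‖ := mul_le_of_le_one_left (norm_nonneg _) h3
  · rw [← hf]
    conv_lhs => rw [hT, map_sum]
    rfl

lemma nu1_le_of_hasTypeTwo [FiniteDimensional ℝ Y]
    (hTstar : ∀ (ψ : Y →L[ℝ] ℝ) (i : Fin n),
      (WithLp.equiv ⊤ (Fin n → ℝ)) (Tstar ψ) i = ψ (T (l1basis n i)))
    {C c : ℝ} (hC : HasTypeTwo Y C) (hc : IsTwoSummingBound Tstar c) :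
    nu1 T ≤ √2 * C * c := by
  obtain ⟨s, hs, hnu⟩ := exists_coordinates_sum_eq_nu1 T
  set K := √2 * C with hKdef
  have hK0 : 0 ≤ K := mul_nonneg (Real.sqrt_nonneg _) hC.1
  have key : ∀ η : ℝ, 0 < η → nu1 T ≤ (K + n * η) * c := by
    intro η hη
    obtain ⟨μ, hμ, hsum, hle⟩ := exists_weights_of_square_function_le s (pow_pos hη 2)
      (fun k y => hC.sum_sqrt_le s hs y) hK0
    rw [Real.sqrt_sq hη.le] at hsum hle
    set L := K + n * η with hL
    have hL0 : 0 ≤ L := by positivity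
    let ψ : Fin n → (Y →L[ℝ] ℝ) := fun i => (√(μ i))⁻¹ • s i
    have hψ : ∀ i y, ψ i y ^ 2 = s i y ^ 2 / μ i := by
      intro i y
      simp only [ψ, smul_apply, smul_eq_mul, mul_pow, inv_pow, Real.sq_sqrt (hμ i).le]
      ring
    have hw : weakTwoNorm ψ ≤ √L := by
      refine weakTwoNorm_dual_le ψ fun y hy => Real.sqrt_le_sqrt ?_
      simpa only [hψ] using hle y hy
    have h1 : √(∑ i, s i (T (l1basis n i)) ^ 2 / μ i) ≤ c * √L := by
      refine le_trans ?_ ((hc.2 n ψ).trans (mul_le_mul_of_nonneg_left hw hc.1))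
      refine Real.sqrt_le_sqrt (Finset.sum_le_sum fun i _ => ?_)
      rw [← hψ, ← hTstar, ← sq_abs]
      gcongr
      exact PiLp.norm_apply_le (Tstar (ψ i)) i
    calc nu1 T = ∑ i, √(μ i) * (s i (T (l1basis n i)) / √(μ i)) := by
          rw [hnu]
          refine Finset.sum_congr rfl fun i _ => ?_
          rw [mul_div_cancel₀ _ (Real.sqrt_pos.2 (hμ i)).ne']
      _ ≤ √(∑ i, √(μ i) ^ 2) * √(∑ i, (s i (T (l1basis n i)) / √(μ i)) ^ 2) :=
          Real.sum_mul_le_sqrt_mul_sqrt _ _ _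
      _ = √(∑ i, μ i) * √(∑ i, s i (T (l1basis n i)) ^ 2 / μ i) := by
          simp only [div_pow, Real.sq_sqrt (hμ _).le]
      _ ≤ √L * (c * √L) := by gcongr
      _ = (√L * √L) * c := by ring
      _ = L * c := by rw [Real.mul_self_sqrt hL0]
  have hlim : Filter.Tendsto (fun η : ℝ => (K + n * η) * c) (nhdsWithin 0 (Ioi 0))
      (nhds (K * c)) := by
    have h : Continuous fun η : ℝ => (K + n * η) * c := by fun_prop
    simpa using (h.tendsto 0).mono_left nhdsWithin_le_nhds
  exact ge_of_tendsto hlim (eventually_mem_nhdsWithin.mono key)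

end Adjoint

lemma le_mul_sInf {S : Set ℝ} (hne : S.Nonempty) {a x : ℝ} (ha : 0 ≤ a)
    (h : ∀ c ∈ S, x ≤ a * c) : x ≤ a * sInf S := by
  rw [← smul_eq_mul, ← Real.sInf_smul_of_nonneg ha]
  refine le_csInf hne.smul_set ?_
  rintro _ ⟨c, hc, rfl⟩
  exact h c hc

theorem stmt_5
    (n : ℕ) (hn : 0 < n)
    (Y : Type) [NormedAddCommGroup Y] [NormedSpace ℝ Y] [FiniteDimensional ℝ Y]
    (T : PiLp 1 (fun _ : Fin n => ℝ) →L[ℝ] Y)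
    -- the adjoint `T* : Y* → ℓ∞^n`, `(T*ψ)_i = ψ(T e_i)`
    (Tstar : (Y →L[ℝ] ℝ) →L[ℝ] PiLp ⊤ (fun _ : Fin n => ℝ))
    (hTstar : ∀ (ψ : Y →L[ℝ] ℝ) (i : Fin n),
      (WithLp.equiv ⊤ (Fin n → ℝ)) (Tstar ψ) i = ψ (T (l1basis n i))) :
    pi2 Tstar ≤ nu1 T ∧ nu1 T ≤ Real.sqrt 2 * type2Const Y * pi2 Tstar := by
  have hne := nuclearValues_nonempty T
  have hsub : ∀ c ∈ nuclearValues T, IsTwoSummingBound Tstar c := fun c hc =>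
    isTwoSummingBound_of_mem_nuclearValues hTstar hc
  refine ⟨le_csInf hne fun c hc => csInf_le ⟨0, fun _ h => h.1⟩ (hsub c hc), ?_⟩
  have htype0 : 0 ≤ type2Const Y := Real.sInf_nonneg fun C hC => hC.1
  refine le_mul_sInf (hne.mono hsub) (by positivity) fun c hc => ?_
  rw [mul_right_comm]
  refine le_mul_sInf (S := {C | HasTypeTwo Y C}) exists_hasTypeTwo
    (mul_nonneg (Real.sqrt_nonneg 2) hc.1) fun C hC => ?_
  rw [mul_right_comm]
  exact nu1_le_of_hasTypeTwo hTstar hC hc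
end

section
/- Let X and Y be finite-dimensional real normed spaces and T : X* → Y a linear map, with adjoint T* : Y* → X (using the canonical identification X** = X). Then π2(T*) = inf{π2(S1) · ‖S2‖ : d ∈ ℕ, S1 : Y* → ℓ2^d linear, S2 : ℓ2^d → X linear, T* = S2 ∘ S1}. -/
open Real Set

section TwoSumming

set_option maxSynthPendingDepth 3

variable {F G H : Type*} [NormedAddCommGroup F] [NormedSpace ℝ F]
  [NormedAddCommGroup G] [NormedSpace ℝ G] [NormedAddCommGroup H] [NormedSpace ℝ H]

/-- `c` is a 2-summing constant of `S`: every bound `r` on the weak square sums of a finite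
family yields the bound `c ^ 2 * r` on the strong square sums of its image. -/
def IsTwoSummingConst (S : F →L[ℝ] G) (c : ℝ) : Prop :=
  0 ≤ c ∧ ∀ (k : ℕ) (x : Fin k → F) (r : ℝ),
    (∀ φ : F →L[ℝ] ℝ, ‖φ‖ ≤ 1 → ∑ i, φ (x i) ^ 2 ≤ r) → ∑ i, ‖S (x i)‖ ^ 2 ≤ c ^ 2 * r

lemma sq_apply_le {φ : F →L[ℝ] ℝ} (hφ : ‖φ‖ ≤ 1) (x : F) : φ x ^ 2 ≤ ‖x‖ ^ 2 := by
  rw [sq_le_sq, abs_norm]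
  simpa using φ.le_of_opNorm_le hφ x

lemma bddAbove_weak_norms {k : ℕ} (x : Fin k → F) :
    BddAbove {t | ∃ φ : F →L[ℝ] ℝ, ‖φ‖ ≤ 1 ∧ t = √(∑ i, φ (x i) ^ 2)} := by
  refine ⟨√(∑ i, ‖x i‖ ^ 2), ?_⟩
  rintro t ⟨φ, hφ, rfl⟩
  exact Real.sqrt_le_sqrt (Finset.sum_le_sum fun i _ => sq_apply_le hφ (x i))

lemma isTwoSummingConst_iff {S : F →L[ℝ] G} {c : ℝ} :
    IsTwoSummingConst S c ↔ 0 ≤ c ∧ ∀ (k : ℕ) (x : Fin k → F), √(∑ i, ‖S (x i)‖ ^ 2)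
      ≤ c * sSup {t | ∃ φ : F →L[ℝ] ℝ, ‖φ‖ ≤ 1 ∧ t = √(∑ i, φ (x i) ^ 2)} := by
  refine and_congr_right fun hc => forall₂_congr fun k x => ⟨fun h => ?_, fun h r hr => ?_⟩
  · set M := sSup {t | ∃ φ : F →L[ℝ] ℝ, ‖φ‖ ≤ 1 ∧ t = √(∑ i, φ (x i) ^ 2)}
    have hle : ∀ φ : F →L[ℝ] ℝ, ‖φ‖ ≤ 1 → √(∑ i, φ (x i) ^ 2) ≤ M := fun φ hφ =>
      le_csSup (bddAbove_weak_norms x) ⟨φ, hφ, rfl⟩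
    have hM0 : 0 ≤ M := (Real.sqrt_nonneg _).trans (hle 0 (by simp))
    refine Real.sqrt_le_iff.2 ⟨by positivity, ?_⟩
    rw [mul_pow]
    exact h _ fun φ hφ => (Real.sqrt_le_left hM0).1 (hle φ hφ)
  · have hr0 : 0 ≤ r := by simpa using hr 0 (by simp)
    have hsup : sSup {t | ∃ φ : F →L[ℝ] ℝ, ‖φ‖ ≤ 1 ∧ t = √(∑ i, φ (x i) ^ 2)} ≤ √r := by
      refine csSup_le ⟨_, 0, by simp, rfl⟩ ?_
      rintro t ⟨φ, hφ, rfl⟩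
      exact Real.sqrt_le_sqrt (hr φ hφ)
    have := (Real.sqrt_le_iff.1 (h.trans (mul_le_mul_of_nonneg_left hsup hc))).2
    rwa [mul_pow, Real.sq_sqrt hr0] at this

lemma pi2_eq_sInf (S : F →L[ℝ] G) : pi2 S = sInf {c | IsTwoSummingConst S c} := by
  simp only [pi2, isTwoSummingConst_iff]

lemma IsTwoSummingConst.pi2_le {S : F →L[ℝ] G} {c : ℝ} (h : IsTwoSummingConst S c) :
    pi2 S ≤ c := by
  rw [pi2_eq_sInf]
  exact csInf_le ⟨0, fun _ hb => hb.1⟩ h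

lemma pi2_nonneg (S : F →L[ℝ] G) : 0 ≤ pi2 S := by
  rw [pi2_eq_sInf]
  exact Real.sInf_nonneg fun _ hb => hb.1

lemma IsTwoSummingConst.comp_left {S : F →L[ℝ] G} {c : ℝ} (h : IsTwoSummingConst S c)
    (R : G →L[ℝ] H) : IsTwoSummingConst (R.comp S) (c * ‖R‖) := by
  refine ⟨mul_nonneg h.1 (norm_nonneg _), fun k x r hr => ?_⟩
  calc ∑ i, ‖R (S (x i))‖ ^ 2 ≤ ∑ i, (‖R‖ * ‖S (x i)‖) ^ 2 := by
        gcongr with i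
        exact R.le_opNorm _
    _ = ‖R‖ ^ 2 * ∑ i, ‖S (x i)‖ ^ 2 := by simp only [mul_pow, Finset.mul_sum]
    _ ≤ ‖R‖ ^ 2 * (c ^ 2 * r) := by
        gcongr
        exact h.2 k x r hr
    _ = (c * ‖R‖) ^ 2 * r := by ring

/-- A linear map into a Euclidean space is 2-summing. -/
lemma exists_isTwoSummingConst_euclidean {d : ℕ} (S : F →L[ℝ] EuclideanSpace ℝ (Fin d)) :
    ∃ c, IsTwoSummingConst S c := by
  let ψ : Fin d → F →L[ℝ] ℝ := fun j => (EuclideanSpace.proj j).comp S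
  refine ⟨√(∑ j, ‖ψ j‖ ^ 2), Real.sqrt_nonneg _, fun k x r hr => ?_⟩
  have hr0 : 0 ≤ r := by simpa using hr 0 (by simp)
  rw [Real.sq_sqrt (by positivity), Finset.sum_mul]
  simp only [EuclideanSpace.real_norm_sq_eq]
  rw [Finset.sum_comm]
  refine Finset.sum_le_sum fun j _ => ?_
  change ∑ i, ψ j (x i) ^ 2 ≤ _
  rcases eq_or_ne (ψ j) 0 with h0 | h0
  · simp [h0]
  · have hn : 0 < ‖ψ j‖ := norm_pos_iff.2 h0
    have := hr (‖ψ j‖⁻¹ • ψ j) (by rw [norm_smul]; simp [hn.ne'])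
    simp only [smul_apply, smul_eq_mul, mul_pow, ← Finset.mul_sum] at this
    rw [inv_pow, inv_mul_le_iff₀ (by positivity)] at this
    exact this

lemma exists_isTwoSummingConst [FiniteDimensional ℝ F] (S : F →L[ℝ] G) :
    ∃ c, IsTwoSummingConst S c := by
  let e := toEuclidean (E := F)
  obtain ⟨c, hc⟩ := exists_isTwoSummingConst_euclidean e.toContinuousLinearMap
  have hS : S = (S.comp e.symm.toContinuousLinearMap).comp e.toContinuousLinearMap := by
    ext x
    simp
  rw [hS]
  exact ⟨_, hc.comp_left _⟩

lemma isTwoSummingConst_pi2 [FiniteDimensional ℝ F] (S : F →L[ℝ] G) :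
    IsTwoSummingConst S (pi2 S) := by
  have hcl : IsClosed {c | IsTwoSummingConst S c} := by
    simp only [IsTwoSummingConst, ofPred_and, ofPred_forall]
    refine isClosed_Ici.inter <| isClosed_iInter fun k => isClosed_iInter fun x =>
      isClosed_iInter fun r => isClosed_iInter fun _ => isClosed_le ?_ ?_ <;> fun_prop
  rw [pi2_eq_sInf]
  exact hcl.csInf_mem (exists_isTwoSummingConst S) ⟨0, fun _ hb => hb.1⟩

lemma IsTwoSummingConst.weighted_sum_le {S : F →L[ℝ] G} {c : ℝ} (h : IsTwoSummingConst S c)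
    {ι : Type*} [Fintype ι] (x : ι → F) {w : ι → ℝ} (hw : ∀ i, 0 ≤ w i) {r : ℝ}
    (hr : ∀ φ : F →L[ℝ] ℝ, ‖φ‖ ≤ 1 → ∑ i, w i * φ (x i) ^ 2 ≤ r) :
    ∑ i, w i * ‖S (x i)‖ ^ 2 ≤ c ^ 2 * r := by
  let e := (Fintype.equivFin ι).symm
  have key := h.2 _ (fun j => √(w (e j)) • x (e j)) r fun φ hφ => by
    simp only [map_smul, smul_eq_mul, mul_pow, Real.sq_sqrt (hw _)]
    rw [e.sum_comp fun i => w i * φ (x i) ^ 2]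
    exact hr φ hφ
  simp only [map_smul, norm_smul, mul_pow, Real.norm_eq_abs, sq_abs, Real.sq_sqrt (hw _)] at key
  rwa [e.sum_comp fun i => w i * ‖S (x i)‖ ^ 2] at key

/-- The closed convex hull of the rank-one bilinear forms `φ ⊗ φ` with `‖φ‖ ≤ 1`. -/
def pietschForms (F : Type*) [NormedAddCommGroup F] [NormedSpace ℝ F] :
    Set (F →L[ℝ] F →L[ℝ] ℝ) :=
  closure (convexHull ℝ ((fun φ : F →L[ℝ] ℝ => (φ.smulRight φ : F →L[ℝ] F →L[ℝ] ℝ)) '' Metric.closedBall 0 1))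

lemma smulRight_mem_pietschForms {φ : F →L[ℝ] ℝ} (hφ : ‖φ‖ ≤ 1) :
    φ.smulRight φ ∈ pietschForms F :=
  subset_closure (subset_convexHull ℝ _ ⟨φ, by simpa using hφ, rfl⟩)

lemma convex_pietschForms : Convex ℝ (pietschForms F) := (convex_convexHull ℝ _).closure

lemma isCompact_pietschForms [FiniteDimensional ℝ F] : IsCompact (pietschForms F) := by
  refine Metric.isCompact_of_isClosed_isBounded isClosed_closure (Bornology.IsBounded.closure ?_)
  rw [isBounded_convexHull, isBounded_iff_forall_norm_le]
  refine ⟨1, ?_⟩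
  rintro _ ⟨φ, hφ, rfl⟩
  rw [mem_closedBall_zero_iff] at hφ
  simp only [ContinuousLinearMap.norm_smulRight_apply]
  exact mul_le_one₀ hφ (norm_nonneg _) hφ

lemma le_of_mem_pietschForms {q : F →L[ℝ] F →L[ℝ] ℝ} (hq : q ∈ pietschForms F)
    (L : (F →L[ℝ] F →L[ℝ] ℝ) →L[ℝ] ℝ) {r : ℝ}
    (hL : ∀ φ : F →L[ℝ] ℝ, ‖φ‖ ≤ 1 → L (φ.smulRight φ) ≤ r) : L q ≤ r := by
  refine closure_minimal (convexHull_min ?_ (convex_halfSpace_le L.toLinearMap.isLinear r))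
    (isClosed_le L.continuous continuous_const) hq
  rintro _ ⟨φ, hφ, rfl⟩
  exact hL φ (by simpa using hφ)

/-- Evaluation of a bilinear form at a pair of vectors, as a continuous linear functional. -/
noncomputable def evalForm (x y : F) : (F →L[ℝ] F →L[ℝ] ℝ) →L[ℝ] ℝ :=
  (ContinuousLinearMap.apply ℝ ℝ y).comp (ContinuousLinearMap.apply ℝ (F →L[ℝ] ℝ) x)

@[simp]
lemma evalForm_apply (x y : F) (q : F →L[ℝ] F →L[ℝ] ℝ) : evalForm x y q = q x y := rfl

lemma IsTwoSummingConst.exists_form_finite [FiniteDimensional ℝ F] {S : F →L[ℝ] G} {c : ℝ}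
    (h : IsTwoSummingConst S c) {ι : Type*} [Fintype ι] (x : ι → F) :
    ∃ q ∈ pietschForms F, ∀ i, ‖S (x i)‖ ^ 2 ≤ c ^ 2 * q (x i) (x i) := by
  classical
  let A : (F →L[ℝ] F →L[ℝ] ℝ) →L[ℝ] (ι → ℝ) :=
    ContinuousLinearMap.pi fun i => c ^ 2 • evalForm (x i) (x i)
  let b : ι → ℝ := fun i => ‖S (x i)‖ ^ 2
  by_cases hdisj : Disjoint (A '' pietschForms F) (Ici b)
  · exfalso
    obtain ⟨f, u, v, hu, huv, hv⟩ := geometric_hahn_banach_compact_closed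
      (convex_pietschForms.linear_image A.toLinearMap)
      (isCompact_pietschForms.image A.continuous) (convex_Ici b) isClosed_Ici hdisj
    let w : ι → ℝ := fun i => f (Pi.single i 1)
    have hf : ∀ z, f z = ∑ i, w i * z i := fun z => by
      conv_lhs => rw [pi_eq_sum_univ' z, map_sum]
      refine Finset.sum_congr rfl fun i _ => ?_
      rw [map_smul, smul_eq_mul, mul_comm]
    have hw : ∀ i, 0 ≤ w i := fun i => by
      by_contra! hi
      have hb := hv b (mem_Ici.2 le_rfl)
      have := hv (b + ((f b - v) / -w i) • Pi.single i 1) (by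
        refine mem_Ici.2 (le_add_of_nonneg_right (smul_nonneg ?_ ?_))
        · exact div_nonneg (by linarith) (by linarith)
        · exact Pi.single_nonneg.2 zero_le_one)
      rw [map_add, map_smul, smul_eq_mul] at this
      change v < f b + (f b - v) / -w i * w i at this
      have hcancel : (f b - v) / -w i * w i = -(f b - v) := by
        rw [div_neg, neg_mul, div_mul_cancel₀ _ hi.ne]
      linarith
    have hsum : ∀ φ : F →L[ℝ] ℝ, ‖φ‖ ≤ 1 → c ^ 2 * ∑ i, w i * φ (x i) ^ 2 ≤ u := fun φ hφ => by
      refine le_trans (le_of_eq ?_) (hu _ ⟨_, smulRight_mem_pietschForms hφ, rfl⟩).le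
      rw [hf, Finset.mul_sum]
      refine Finset.sum_congr rfl fun i _ => ?_
      simp [A]
      ring
    have hb : ∑ i, w i * ‖S (x i)‖ ^ 2 ≤ u := by
      rcases h.1.eq_or_lt with hc | hc
      · have hS := h.weighted_sum_le x hw (r := ∑ i, w i * ‖x i‖ ^ 2) fun φ hφ =>
          Finset.sum_le_sum fun i _ => mul_le_mul_of_nonneg_left (sq_apply_le hφ _) (hw i)
        have hu0 : 0 ≤ u := by simpa using hsum 0 (by simp)
        simp only [← hc] at hS
        linarith
      · have hS := h.weighted_sum_le x hw (r := u / c ^ 2) fun φ hφ => by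
          rw [le_div_iff₀' (by positivity)]
          exact hsum φ hφ
        rwa [mul_div_cancel₀ _ (by positivity)] at hS
    have := hv b (mem_Ici.2 le_rfl)
    rw [hf] at this
    simp only [b] at this
    linarith
  · obtain ⟨_, ⟨q, hq, rfl⟩, hle⟩ := Set.not_disjoint_iff.1 hdisj
    exact ⟨q, hq, fun i => by simpa [A, b] using hle i⟩

/-- Pietsch domination: a 2-summing map is dominated by a form in `pietschForms`. -/
lemma IsTwoSummingConst.exists_form [FiniteDimensional ℝ F] {S : F →L[ℝ] G} {c : ℝ}
    (h : IsTwoSummingConst S c) :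
    ∃ q ∈ pietschForms F, ∀ x, ‖S x‖ ^ 2 ≤ c ^ 2 * q x x := by
  have hcl : ∀ x : F, IsClosed {q : F →L[ℝ] F →L[ℝ] ℝ | ‖S x‖ ^ 2 ≤ c ^ 2 * q x x} := fun x =>
    isClosed_le continuous_const (continuous_const.mul (evalForm x x).continuous)
  obtain ⟨q, hq, hqx⟩ := isCompact_pietschForms.inter_iInter_nonempty _ hcl fun s => by
    obtain ⟨q, hq, hqs⟩ := h.exists_form_finite (fun x : s => (x : F))
    exact ⟨q, hq, by simpa using hqs⟩
  exact ⟨q, hq, by simpa using hqx⟩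

lemma exists_sum_sq_eq_of_mem_pietschForms [FiniteDimensional ℝ F] {q : F →L[ℝ] F →L[ℝ] ℝ}
    (hq : q ∈ pietschForms F) :
    ∃ (d : ℕ) (ψ : Fin d → F →L[ℝ] ℝ), ∀ x, q x x = ∑ j, ψ j x ^ 2 := by
  have hsymm : ∀ x y, q x y ≤ q y x := fun x y => by
    have := le_of_mem_pietschForms hq (evalForm x y - evalForm y x) (r := 0) fun φ _ => by
      simp [mul_comm]
    simpa using this
  have hnonneg : ∀ x, 0 ≤ q x x := fun x => by
    have := le_of_mem_pietschForms hq (-evalForm x x) (r := 0) fun φ _ => by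
      simpa using mul_self_nonneg (φ x)
    simpa using this
  let b := Module.finBasis ℝ F
  let M : Matrix _ _ ℝ := Matrix.of fun i j => q (b i) (b j)
  have hM : ∀ z, z ⬝ᵥ M.mulVec z = q (∑ i, z i • b i) (∑ i, z i • b i) := fun z => by
    simp only [M, dotProduct, Matrix.mulVec, Matrix.of_apply, map_sum, map_smul, sum_apply,
      smul_apply, smul_eq_mul, Finset.mul_sum]
    rw [Finset.sum_comm]
    exact Finset.sum_congr rfl fun i _ => Finset.sum_congr rfl fun j _ => by ring
  have hpos : M.PosSemidef := by
    refine Matrix.posSemidef_iff_dotProduct_mulVec.2 ⟨?_, fun z => ?_⟩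
    · ext i j
      exact le_antisymm (hsymm _ _) (hsymm _ _)
    · rw [star_trivial, hM]
      exact hnonneg _
  obtain ⟨d, v, hv⟩ := Matrix.posSemidef_iff_eq_sum_vecMulVec.1 hpos
  refine ⟨d, fun j => LinearMap.toContinuousLinearMap (∑ i, v j i • b.coord i), fun x => ?_⟩
  have hx := hM (b.repr x)
  rw [b.sum_repr] at hx
  rw [← hx, hv, Matrix.sum_mulVec, dotProduct_sum]
  refine Finset.sum_congr rfl fun j _ => ?_
  rw [Matrix.vecMulVec_mulVec]
  simp [dotProduct, sq, Finset.mul_sum, mul_comm, mul_left_comm]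

/-- A map dominated by a map into a Euclidean space factors through it by a contraction. -/
lemma exists_contraction_comp_eq {E : Type*} [NormedAddCommGroup E] [InnerProductSpace ℝ E]
    [FiniteDimensional ℝ E] {S : F →L[ℝ] G} {S₁ : F →L[ℝ] E} (h : ∀ x, ‖S x‖ ≤ ‖S₁ x‖) :
    ∃ S₂ : E →L[ℝ] G, S = S₂.comp S₁ ∧ ‖S₂‖ ≤ 1 := by
  let R : Submodule ℝ E := LinearMap.range S₁.toLinearMap
  obtain ⟨g, hg⟩ := S₁.toLinearMap.rangeRestrict.exists_rightInverse_of_surjective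
    (LinearMap.range_rangeRestrict _)
  have hg' : ∀ z : R, S₁ (g z) = z := fun z => congrArg Subtype.val (LinearMap.congr_fun hg z)
  refine ⟨(S.comp (LinearMap.toContinuousLinearMap g)).comp R.orthogonalProjectionOnto, ?_, ?_⟩
  · ext x
    have hx : R.orthogonalProjectionOnto (S₁ x) = ⟨S₁ x, x, rfl⟩ :=
      R.orthogonalProjectionOnto_mem_subspace_eq_self ⟨S₁ x, x, rfl⟩
    have := h (x - g ⟨S₁ x, x, rfl⟩)
    rw [map_sub, map_sub, hg', sub_self, norm_zero, norm_le_zero_iff, sub_eq_zero] at this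
    simpa [hx] using this
  · refine ContinuousLinearMap.opNorm_le_bound _ zero_le_one fun z => ?_
    rw [one_mul]
    refine (h _).trans ?_
    change ‖S₁ (g (R.orthogonalProjectionOnto z))‖ ≤ _
    rw [hg']
    exact R.norm_orthogonalProjectionOnto_apply_le z

/-- A 2-summing map factors through a Euclidean space without loss of the constant. -/
lemma IsTwoSummingConst.exists_factorization [FiniteDimensional ℝ F] {S : F →L[ℝ] G} {c : ℝ}
    (h : IsTwoSummingConst S c) :
    ∃ (d : ℕ) (S₁ : F →L[ℝ] EuclideanSpace ℝ (Fin d)) (S₂ : EuclideanSpace ℝ (Fin d) →L[ℝ] G),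
      S = S₂.comp S₁ ∧ IsTwoSummingConst S₁ c ∧ ‖S₂‖ ≤ 1 := by
  obtain ⟨q, hq, hqS⟩ := h.exists_form
  obtain ⟨d, ψ, hψ⟩ := exists_sum_sq_eq_of_mem_pietschForms hq
  let S₁ : F →L[ℝ] EuclideanSpace ℝ (Fin d) :=
    ((EuclideanSpace.equiv (Fin d) ℝ).symm : (Fin d → ℝ) →L[ℝ] _).comp
      (ContinuousLinearMap.pi fun j => c • ψ j)
  have hS₁ : ∀ x, ‖S₁ x‖ ^ 2 = c ^ 2 * q x x := fun x => by
    simp [EuclideanSpace.real_norm_sq_eq, S₁, hψ, mul_pow, Finset.mul_sum]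
  obtain ⟨S₂, hcomp, hS₂⟩ := exists_contraction_comp_eq (S := S) (S₁ := S₁) fun x =>
    (sq_le_sq₀ (norm_nonneg _) (norm_nonneg _)).1 ((hqS x).trans_eq (hS₁ x).symm)
  refine ⟨d, S₁, S₂, hcomp, ⟨h.1, fun k x r hr => ?_⟩, hS₂⟩
  simp only [hS₁, ← Finset.mul_sum]
  gcongr
  have := le_of_mem_pietschForms hq (∑ i, evalForm (x i) (x i)) (r := r) fun φ hφ => by
    simpa [sq] using hr φ hφ
  simpa using this

end TwoSumming

theorem stmt_7
    (X Y : Type) [NormedAddCommGroup X] [NormedSpace ℝ X] [FiniteDimensional ℝ X]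
    [NormedAddCommGroup Y] [NormedSpace ℝ Y] [FiniteDimensional ℝ Y]
    (T : (X →L[ℝ] ℝ) →L[ℝ] Y)
    -- the adjoint `T* : Y* → X` (with the canonical identification `X** = X`):
    -- `φ(T*ψ) = ψ(T φ)` for all `φ ∈ X*`, `ψ ∈ Y*`
    (Tstar : (Y →L[ℝ] ℝ) →L[ℝ] X)
    (hTstar : ∀ (ψ : Y →L[ℝ] ℝ) (φ : X →L[ℝ] ℝ), φ (Tstar ψ) = ψ (T φ)) :
    pi2 Tstar = sInf {c | ∃ (d : ℕ)
      (S1 : (Y →L[ℝ] ℝ) →L[ℝ] EuclideanSpace ℝ (Fin d))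
      (S2 : EuclideanSpace ℝ (Fin d) →L[ℝ] X),
      Tstar = S2.comp S1 ∧ c = pi2 S1 * ‖S2‖} := by
  refine le_antisymm (le_csInf ?_ ?_) ?_
  · obtain ⟨d, S₁, S₂, h, -⟩ := (isTwoSummingConst_pi2 Tstar).exists_factorization
    exact ⟨_, d, S₁, S₂, h, rfl⟩
  · rintro _ ⟨d, S₁, S₂, rfl, rfl⟩
    exact ((isTwoSummingConst_pi2 S₁).comp_left S₂).pi2_le
  · obtain ⟨d, S₁, S₂, h, h₁, h₂⟩ := (isTwoSummingConst_pi2 Tstar).exists_factorization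
    have hbdd : ∀ c ∈ {c | ∃ (d : ℕ) (R₁ : (Y →L[ℝ] ℝ) →L[ℝ] EuclideanSpace ℝ (Fin d))
        (R₂ : EuclideanSpace ℝ (Fin d) →L[ℝ] X), Tstar = R₂.comp R₁ ∧ c = pi2 R₁ * ‖R₂‖},
        (0 : ℝ) ≤ c := by
      rintro _ ⟨d, R₁, R₂, -, rfl⟩
      exact mul_nonneg (pi2_nonneg _) (norm_nonneg _)
    calc _ ≤ pi2 S₁ * ‖S₂‖ := csInf_le ⟨0, hbdd⟩ ⟨d, S₁, S₂, h, rfl⟩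
      _ ≤ pi2 S₁ := mul_le_of_le_one_right (pi2_nonneg _) h₂
      _ ≤ pi2 Tstar := h₁.pi2_le
end

section
/- Let M ∈ ℝ^{d1×d2} be regarded as a linear map from ℓ1^{d2} to ℓ2^{d1}, with adjoint M* : ℓ2^{d1} → ℓ∞^{d2}. Then π2(M*) = inf{‖U‖_F · ‖Vᵀ‖_{1→2} : d ∈ ℕ, U ∈ ℝ^{d1×d}, V ∈ ℝ^{d2×d}, M = U Vᵀ}, i.e. the 2-summing norm of the adjoint equals the mixed norm ‖M‖_mixed. -/
open Real Set Matrix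

noncomputable def frobNorm {m n : ℕ} (M : Matrix (Fin m) (Fin n) ℝ) : ℝ :=
  Real.sqrt (∑ i, ∑ j, (M i j)^2)

/-- maximum ℓ2 norm of the columns of `M`, i.e. `‖M‖_{1→2}` -/
noncomputable def norm12 {m n : ℕ} (M : Matrix (Fin m) (Fin n) ℝ) : ℝ :=
  ⨆ j, Real.sqrt (∑ i, (M i j)^2)

section Factorization
open scoped MatrixOrder

/-- A real positive semidefinite matrix has a square factorization `Rᵀ * R`. -/
theorem Matrix.PosSemidef.exists_eq_transpose_mul_self {n : ℕ} {A : Matrix (Fin n) (Fin n) ℝ}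
    (hA : A.PosSemidef) : ∃ R : Matrix (Fin n) (Fin n) ℝ, A = Rᵀ * R := by
  obtain ⟨R, hR⟩ := CStarAlgebra.nonneg_iff_eq_star_mul_self.mp hA.nonneg
  exact ⟨R, by rw [hR, star_eq_conjTranspose, conjTranspose_eq_transpose_of_trivial]⟩

end Factorization

theorem Matrix.trace_transpose_mul_self_eq_sum {m n : ℕ} (R : Matrix (Fin m) (Fin n) ℝ) :
    (Rᵀ * R).trace = ∑ i, ∑ j, R i j ^ 2 := by
  rw [Finset.sum_comm]
  simp [trace, mul_apply, sq]

/-- The positive semidefinite matrices of trace at most one. -/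
def subdensity (n : ℕ) : Set (Matrix (Fin n) (Fin n) ℝ) :=
  {A | A.PosSemidef ∧ A.trace ≤ 1}

theorem convex_subdensity (n : ℕ) : Convex ℝ (subdensity n) := by
  rintro A ⟨hA, hA'⟩ B ⟨hB, hB'⟩ a b ha hb hab
  refine ⟨(hA.smul ha).add (hB.smul hb), ?_⟩
  rw [trace_add, trace_smul, trace_smul, smul_eq_mul, smul_eq_mul]
  nlinarith

theorem isCompact_subdensity (n : ℕ) : IsCompact (subdensity n) := by
  have hball : IsCompact {R : Fin n → Fin n → ℝ | ∑ i, ∑ j, R i j ^ 2 ≤ 1} := by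
    refine (isCompact_Icc (a := fun _ _ => (-1 : ℝ)) (b := fun _ _ => 1)).of_isClosed_subset
      (isClosed_le (by fun_prop) continuous_const) fun R hR => ?_
    have hR : ∑ i, ∑ j, R i j ^ 2 ≤ 1 := hR
    have hsq (i j) : R i j ^ 2 ≤ 1 :=
      ((Finset.single_le_sum (f := fun j => R i j ^ 2) (fun _ _ => sq_nonneg _)
        (Finset.mem_univ j)).trans
        (Finset.single_le_sum (f := fun i => ∑ j, R i j ^ 2)
          (fun _ _ => Finset.sum_nonneg fun _ _ => sq_nonneg _) (Finset.mem_univ i))).trans hR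
    exact ⟨fun i j => (abs_le.mp ((sq_le_one_iff_abs_le_one _).mp (hsq i j))).1,
      fun i j => (abs_le.mp ((sq_le_one_iff_abs_le_one _).mp (hsq i j))).2⟩
  have hcont : Continuous fun R : Matrix (Fin n) (Fin n) ℝ => Rᵀ * R := by fun_prop
  convert IsCompact.image (X := Matrix (Fin n) (Fin n) ℝ) hball hcont
  ext A
  constructor
  · rintro ⟨hA, htr⟩
    obtain ⟨R, rfl⟩ := hA.exists_eq_transpose_mul_self
    exact ⟨R, by rwa [trace_transpose_mul_self_eq_sum] at htr, rfl⟩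
  · rintro ⟨R, hR, rfl⟩
    refine ⟨?_, by rwa [trace_transpose_mul_self_eq_sum]⟩
    simpa [conjTranspose_eq_transpose_of_trivial] using posSemidef_conjTranspose_mul_self R

/-- A Pietsch-type domination theorem: if every finite nonnegative combination of the values of `q`
is dominated, up to arbitrarily small error, by the same combination of the squares of some
functional in the Euclidean unit ball, then `q` is dominated by a single quadratic form given by
a positive semidefinite matrix of trace at most one. -/
theorem exists_subdensity_dominating {n : ℕ} (q : (Fin n → ℝ) → ℝ) (c : ℝ)
    (h : ∀ (s : Finset (Fin n → ℝ)) (w : (Fin n → ℝ) → ℝ), (∀ x, 0 ≤ w x) → ∀ δ > 0,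
      ∃ φ : Fin n → ℝ, φ ⬝ᵥ φ ≤ 1 ∧
        ∑ x ∈ s, w x * q x < ∑ x ∈ s, w x * (c ^ 2 * (φ ⬝ᵥ x) ^ 2) + δ) :
    ∃ A ∈ subdensity n, ∀ x, q x ≤ c ^ 2 * (x ⬝ᵥ A *ᵥ x) := by
  have hcont (x : Fin n → ℝ) :
      Continuous fun A : Matrix (Fin n) (Fin n) ℝ => c ^ 2 * (x ⬝ᵥ A *ᵥ x) := by fun_prop
  suffices H : (subdensity n ∩ ⋂ x : Fin n → ℝ,
      {A : Matrix (Fin n) (Fin n) ℝ | q x ≤ c ^ 2 * (x ⬝ᵥ A *ᵥ x)}).Nonempty by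
    obtain ⟨A, hA, hAx⟩ := H
    exact ⟨A, hA, by simpa using hAx⟩
  refine (isCompact_subdensity n).inter_iInter_nonempty _
    (fun x => isClosed_le continuous_const (hcont x)) fun s => ?_
  by_contra hempty
  let G : Matrix (Fin n) (Fin n) ℝ → (s → ℝ) := fun A x => q x - c ^ 2 * (x.1 ⬝ᵥ A *ᵥ x.1)
  have hG : Continuous G := continuous_pi fun x => continuous_const.sub (hcont x.1)
  have hconv : Convex ℝ (G '' subdensity n) := by
    rintro _ ⟨A, hA, rfl⟩ _ ⟨B, hB, rfl⟩ a b ha hb hab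
    refine ⟨a • A + b • B, convex_subdensity n hA hB ha hb hab, ?_⟩
    ext x
    simp only [G, add_mulVec, smul_mulVec, dotProduct_add, dotProduct_smul, Pi.add_apply,
      Pi.smul_apply, smul_eq_mul]
    linear_combination (-q x) * hab
  have hdisj : Disjoint (G '' subdensity n) (Iic 0) := by
    rw [Set.disjoint_left]
    rintro _ ⟨A, hA, rfl⟩ hle
    refine hempty ⟨A, hA, ?_⟩
    simp only [mem_iInter, mem_ofPred_eq]
    intro x hx
    simpa [G] using hle ⟨x, hx⟩
  obtain ⟨f, u, v, hfu, huv, hvf⟩ := geometric_hahn_banach_compact_closed hconv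
    ((isCompact_subdensity n).image hG) (convex_Iic 0) isClosed_Iic hdisj
  have hv : v < 0 := by simpa using hvf 0 (by simp)
  classical
  have hf (y : s → ℝ) : f y = ∑ x, y x * f (Pi.single x 1) := by
    conv_lhs => rw [pi_eq_sum_univ' y]
    simp [map_sum]
  have hfneg (x : s) : f (Pi.single x 1) ≤ 0 := by
    by_contra! hpos
    have := hvf ((v / f (Pi.single x 1)) • Pi.single x 1) (by
      intro y
      simp only [Pi.smul_apply, smul_eq_mul, Pi.zero_apply]
      refine mul_nonpos_of_nonpos_of_nonneg (div_nonpos_of_nonpos_of_nonneg hv.le hpos.le) ?_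
      by_cases hxy : y = x <;> simp [hxy])
    rw [map_smul, smul_eq_mul, div_mul_cancel₀ _ hpos.ne'] at this
    exact lt_irrefl _ this
  let w : (Fin n → ℝ) → ℝ := fun x => if hx : x ∈ s then -f (Pi.single ⟨x, hx⟩ 1) else 0
  have hw (x) : 0 ≤ w x := by
    by_cases hx : x ∈ s <;> simp [w, hx, hfneg]
  obtain ⟨φ, hφ, hlt⟩ := h s w hw (-u) (by linarith)
  have hmem : vecMulVec φ φ ∈ subdensity n :=
    ⟨by simpa using posSemidef_vecMulVec_self_star φ, by simpa [trace_vecMulVec] using hφ⟩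
  have hlt' := hfu _ ⟨_, hmem, rfl⟩
  rw [hf, ← Finset.sum_coe_sort s, ← Finset.sum_coe_sort s] at *
  have hval (x : s) : G (vecMulVec φ φ) x * f (Pi.single x 1) =
      w x * (c ^ 2 * (φ ⬝ᵥ x.1) ^ 2) - w x * q x := by
    have hq : x.1 ⬝ᵥ vecMulVec φ φ *ᵥ x.1 = (φ ⬝ᵥ x.1) ^ 2 := by
      rw [vecMulVec_mulVec, dotProduct_smul, dotProduct_comm x.1]
      simp [sq]
    simp only [G, w, hq, x.2, dif_pos]
    ring
  rw [Finset.sum_congr rfl fun x _ => hval x, Finset.sum_sub_distrib] at hlt'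
  linarith

/-- A linear functional dominated by a positive semidefinite form `Rᵀ * R` factors through `R`. -/
theorem exists_transpose_mulVec_eq {n : ℕ} (R : Matrix (Fin n) (Fin n) ℝ) (m : Fin n → ℝ) (c : ℝ)
    (h : ∀ x, (m ⬝ᵥ x) ^ 2 ≤ c ^ 2 * (x ⬝ᵥ (Rᵀ * R) *ᵥ x)) :
    ∃ v, Rᵀ *ᵥ v = m ∧ v ⬝ᵥ v ≤ c ^ 2 := by
  have hquad (x : Fin n → ℝ) : x ⬝ᵥ (Rᵀ * R) *ᵥ x = R *ᵥ x ⬝ᵥ R *ᵥ x := by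
    rw [← mulVec_mulVec, dotProduct_mulVec, vecMul_transpose]
  obtain ⟨z, hz⟩ : ∃ z, (Rᵀ * R) *ᵥ z = m := by
    let T := toEuclideanLin (Rᵀ * R)
    have hT : T.IsSymmetric := by
      rw [isSymmetric_toEuclideanLin_iff]
      simpa [conjTranspose_eq_transpose_of_trivial] using isHermitian_conjTranspose_mul_self R
    have hm : WithLp.toLp 2 m ∈ LinearMap.range T := by
      rw [← Submodule.orthogonal_orthogonal (LinearMap.range T), hT.orthogonal_range,
        Submodule.mem_orthogonal]
      intro x hx
      have hx0 : (Rᵀ * R) *ᵥ x.ofLp = 0 := by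
        simpa [T, toLpLin_apply] using hx
      have := h x.ofLp
      rw [hx0, dotProduct_zero, mul_zero] at this
      simpa [EuclideanSpace.inner_eq_star_dotProduct] using this
    obtain ⟨z, hz⟩ := hm
    exact ⟨z.ofLp, by simpa [T, toLpLin_apply] using congrArg WithLp.ofLp hz⟩
  refine ⟨R *ᵥ z, by rw [mulVec_mulVec, hz], ?_⟩
  have hmz : m ⬝ᵥ z = R *ᵥ z ⬝ᵥ R *ᵥ z := by rw [← hquad, hz, dotProduct_comm]
  have := h z
  rw [hquad, hmz] at this
  nlinarith [sq_nonneg c, sq_nonneg (R *ᵥ z ⬝ᵥ R *ᵥ z - c ^ 2)]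

theorem frobNorm_sq_eq_sum_norm_col_sq {m n : ℕ} (U : Matrix (Fin m) (Fin n) ℝ) :
    frobNorm U ^ 2 = ∑ k, ‖WithLp.toLp 2 (U.col k)‖ ^ 2 := by
  rw [frobNorm, Real.sq_sqrt (by positivity), Finset.sum_comm]
  simp [EuclideanSpace.real_norm_sq_eq]

theorem norm12_nonneg {m n : ℕ} (W : Matrix (Fin m) (Fin n) ℝ) : 0 ≤ norm12 W :=
  Real.iSup_nonneg fun _ => Real.sqrt_nonneg _

theorem sum_sq_le_norm12_sq {m n : ℕ} (W : Matrix (Fin m) (Fin n) ℝ) (j : Fin n) :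
    ∑ i, W i j ^ 2 ≤ norm12 W ^ 2 := by
  rw [← Real.sqrt_le_left (norm12_nonneg W)]
  exact le_ciSup (f := fun j => √(∑ i, W i j ^ 2)) (Set.finite_range _).bddAbove j

section Weak

variable {F : Type*} [NormedAddCommGroup F] [NormedSpace ℝ F] {k : ℕ}

/-- The weak 2-norm of a finite family. -/
noncomputable def weakNorm (x : Fin k → F) : ℝ :=
  sSup {t | ∃ φ : F →L[ℝ] ℝ, ‖φ‖ ≤ 1 ∧ t = Real.sqrt (∑ i, (φ (x i))^2)}

theorem weakNorm_nonneg (x : Fin k → F) : 0 ≤ weakNorm x :=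
  Real.sSup_nonneg (by rintro _ ⟨φ, -, rfl⟩; positivity)

theorem sqrt_sum_sq_le_weakNorm (x : Fin k → F) (φ : F →L[ℝ] ℝ) (hφ : ‖φ‖ ≤ 1) :
    √(∑ i, φ (x i) ^ 2) ≤ weakNorm x := by
  refine le_csSup ⟨√(∑ i, ‖x i‖ ^ 2), ?_⟩ ⟨φ, hφ, rfl⟩
  rintro _ ⟨ψ, hψ, rfl⟩
  refine Real.sqrt_le_sqrt (Finset.sum_le_sum fun i _ => ?_)
  rw [sq_le_sq, abs_norm]
  simpa using ψ.le_of_opNorm_le hψ (x i)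

theorem sum_sq_le_opNorm_mul_weakNorm (x : Fin k → F) (φ : F →L[ℝ] ℝ) :
    ∑ i, φ (x i) ^ 2 ≤ ‖φ‖ ^ 2 * weakNorm x ^ 2 := by
  rcases eq_or_ne φ 0 with rfl | hφ
  · simp
  have hpos : 0 < ‖φ‖ := norm_pos_iff.mpr hφ
  have h := sqrt_sum_sq_le_weakNorm x (‖φ‖⁻¹ • φ) (by rw [norm_smul]; simp [hpos.ne'])
  rw [Real.sqrt_le_left (weakNorm_nonneg x)] at h
  simp only [_root_.smul_apply, smul_eq_mul, mul_pow, ← Finset.mul_sum, inv_pow] at h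
  rwa [inv_mul_le_iff₀ (by positivity)] at h

end Weak

section Adjoint

variable {d1 d2 : ℕ} {M : Matrix (Fin d1) (Fin d2) ℝ}
  {Mstar : EuclideanSpace ℝ (Fin d1) →L[ℝ] PiLp ⊤ (fun _ : Fin d2 => ℝ)}

/-- A factorization `M = U * Vᵀ` bounds the 2-summing norm of the adjoint. -/
theorem summing_of_factorization [Nonempty (Fin d2)]
    (hMstar : ∀ u j, Mstar u j = ∑ i, M i j * u i)
    {d : ℕ} {U : Matrix (Fin d1) (Fin d) ℝ} {V : Matrix (Fin d2) (Fin d) ℝ} (hM : M = U * Vᵀ)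
    (k : ℕ) (x : Fin k → EuclideanSpace ℝ (Fin d1)) :
    √(∑ i, ‖Mstar (x i)‖ ^ 2) ≤ frobNorm U * norm12 Vᵀ * weakNorm x := by
  let u (l : Fin d) : EuclideanSpace ℝ (Fin d1) := WithLp.toLp 2 (U.col l)
  have hcoord (y : EuclideanSpace ℝ (Fin d1)) (j : Fin d2) :
      Mstar y j = ∑ l, V j l * innerSL ℝ (u l) y := by
    simp only [hMstar, hM, mul_apply, transpose_apply, Finset.sum_mul, innerSL_apply_apply,
      PiLp.inner_apply, Finset.mul_sum, u, col_apply]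
    rw [Finset.sum_comm]
    refine Finset.sum_congr rfl fun l _ => Finset.sum_congr rfl fun i _ => ?_
    simp
    ring
  have hpoint (y : EuclideanSpace ℝ (Fin d1)) :
      ‖Mstar y‖ ^ 2 ≤ norm12 Vᵀ ^ 2 * ∑ l, innerSL ℝ (u l) y ^ 2 := by
    rw [← Real.le_sqrt (norm_nonneg _) (by positivity), PiLp.norm_eq_ciSup]
    refine ciSup_le fun j => ?_
    rw [Real.norm_eq_abs, hcoord]
    refine Real.abs_le_sqrt ((Finset.sum_mul_sq_le_sq_mul_sq _ _ _).trans ?_)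
    gcongr
    exact sum_sq_le_norm12_sq Vᵀ j
  refine Real.sqrt_le_left (mul_nonneg (mul_nonneg (Real.sqrt_nonneg _) (norm12_nonneg _)) (weakNorm_nonneg x))
    |>.mpr ?_
  calc ∑ i, ‖Mstar (x i)‖ ^ 2
      ≤ ∑ i, norm12 Vᵀ ^ 2 * ∑ l, innerSL ℝ (u l) (x i) ^ 2 :=
        Finset.sum_le_sum fun i _ => hpoint (x i)
    _ = norm12 Vᵀ ^ 2 * ∑ l, ∑ i, innerSL ℝ (u l) (x i) ^ 2 := by
        rw [← Finset.mul_sum, Finset.sum_comm]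
    _ ≤ norm12 Vᵀ ^ 2 * ∑ l, ‖u l‖ ^ 2 * weakNorm x ^ 2 := by
        gcongr with l
        simpa only [innerSL_apply_norm] using sum_sq_le_opNorm_mul_weakNorm x (innerSL ℝ (u l))
    _ = (frobNorm U * norm12 Vᵀ * weakNorm x) ^ 2 := by
        rw [← Finset.sum_mul, mul_pow, mul_pow, frobNorm_sq_eq_sum_norm_col_sq]
        ring

/-- A 2-summing bound for the adjoint yields a factorization `M = U * Vᵀ`. -/
theorem exists_factorization_of_summing
    (hMstar : ∀ u j, Mstar u j = ∑ i, M i j * u i) {c : ℝ} (hc : 0 ≤ c)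
    (h : ∀ (k : ℕ) (x : Fin k → EuclideanSpace ℝ (Fin d1)),
      √(∑ i, ‖Mstar (x i)‖ ^ 2) ≤ c * weakNorm x) :
    ∃ (U : Matrix (Fin d1) (Fin d1) ℝ) (V : Matrix (Fin d2) (Fin d1) ℝ),
      M = U * Vᵀ ∧ frobNorm U * norm12 Vᵀ ≤ c := by
  obtain ⟨A, ⟨hA, htr⟩, hdom⟩ := exists_subdensity_dominating
    (fun x => ‖Mstar (WithLp.toLp 2 x)‖ ^ 2) c (by
    intro s w hw δ hδ
    by_contra! hneg
    let y : Fin s.card → EuclideanSpace ℝ (Fin d1) := fun i =>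
      √(w (s.equivFin.symm i)) • WithLp.toLp 2 (s.equivFin.symm i).1
    have hsum (g : (Fin d1 → ℝ) → ℝ) : ∑ i, g (s.equivFin.symm i) = ∑ x ∈ s, g x := by
      rw [Equiv.sum_comp s.equivFin.symm (fun x : s => g x), Finset.sum_coe_sort]
    have hstar : ∑ i, ‖Mstar (y i)‖ ^ 2 = ∑ x ∈ s, w x * ‖Mstar (WithLp.toLp 2 x)‖ ^ 2 := by
      rw [← hsum]
      refine Finset.sum_congr rfl fun i _ => ?_
      rw [map_smul, norm_smul, mul_pow, Real.norm_eq_abs, sq_abs, Real.sq_sqrt (hw _)]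
    have hweak : c * weakNorm y ≤ √(∑ i, ‖Mstar (y i)‖ ^ 2 - δ) := by
      rw [weakNorm, ← smul_eq_mul, ← Real.sSup_smul_of_nonneg hc]
      refine Real.sSup_le ?_ (Real.sqrt_nonneg _)
      rintro _ ⟨_, ⟨ψ, hψ, rfl⟩, rfl⟩
      let φ := (InnerProductSpace.toDual ℝ (EuclideanSpace ℝ (Fin d1))).symm ψ
      have hφ : ‖φ‖ ≤ 1 := by simpa [φ] using hψ
      have hφ' : φ.ofLp ⬝ᵥ φ.ofLp ≤ 1 := by
        have : ‖φ‖ ^ 2 ≤ 1 := pow_le_one₀ (norm_nonneg _) hφ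
        rwa [EuclideanSpace.real_norm_sq_eq, ← Finset.sum_congr rfl fun i _ => (sq (φ i)).symm]
          at this
      have hψφ (x : EuclideanSpace ℝ (Fin d1)) : ψ x = φ.ofLp ⬝ᵥ x.ofLp := by
        have : inner ℝ φ x = ψ x := InnerProductSpace.toDual_symm_apply
        rw [← this, EuclideanSpace.inner_eq_star_dotProduct, dotProduct_comm]
        simp
      simp only [smul_eq_mul]
      refine Real.le_sqrt_of_sq_le ?_
      rw [mul_pow, Real.sq_sqrt (by positivity), le_sub_iff_add_le, hstar]
      refine le_trans (le_of_eq ?_) (hneg φ.ofLp hφ')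
      rw [← hsum fun x => w x * (c ^ 2 * (φ.ofLp ⬝ᵥ x) ^ 2), Finset.mul_sum]
      congr 1
      refine Finset.sum_congr rfl fun i _ => ?_
      rw [map_smul, hψφ, smul_eq_mul, mul_pow, Real.sq_sqrt (hw _)]
      ring
    have hS : δ ≤ ∑ i, ‖Mstar (y i)‖ ^ 2 := by
      have := hneg 0 (by simp)
      simpa [hstar] using this
    refine absurd ((h _ y).trans hweak) (not_le.mpr (Real.sqrt_lt_sqrt ?_ ?_)) <;> linarith)
  obtain ⟨R, rfl⟩ := hA.exists_eq_transpose_mul_self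
  have hcol (j : Fin d2) : ∃ v, Rᵀ *ᵥ v = M.col j ∧ v ⬝ᵥ v ≤ c ^ 2 := by
    refine exists_transpose_mulVec_eq R _ c fun x => (?_ : _ ≤ _).trans (hdom x)
    have hle := PiLp.norm_apply_le (Mstar (WithLp.toLp 2 x)) j
    rw [hMstar, Real.norm_eq_abs] at hle
    simpa [dotProduct] using sq_le_sq' (neg_le_of_abs_le hle) (le_of_abs_le hle)
  choose v hv hvc using hcol
  refine ⟨Rᵀ, of v, ?_, ?_⟩
  · ext i j
    exact (congrFun (hv j) i).symm
  · have hU : frobNorm Rᵀ ≤ 1 := by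
      rw [frobNorm, Real.sqrt_le_left zero_le_one, one_pow, Finset.sum_comm]
      rwa [trace_transpose_mul_self_eq_sum] at htr
    have hV : norm12 (of v)ᵀ ≤ c := by
      refine Real.iSup_le (fun j => (Real.sqrt_le_left hc).mpr ?_) hc
      simpa [dotProduct, sq] using hvc j
    calc frobNorm Rᵀ * norm12 (of v)ᵀ ≤ 1 * c :=
          mul_le_mul hU hV (norm12_nonneg _) zero_le_one
      _ = c := one_mul c

end Adjoint

theorem stmt_8
    (d1 d2 : ℕ) (hd1 : 0 < d1) (hd2 : 0 < d2)
    (M : Matrix (Fin d1) (Fin d2) ℝ)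
    -- the adjoint `M* : ℓ2^{d1} → ℓ∞^{d2}`, `(M*u)_j = Σ_i M_{ij} u_i`
    (Mstar : EuclideanSpace ℝ (Fin d1) →L[ℝ] PiLp ⊤ (fun _ : Fin d2 => ℝ))
    (hMstar : ∀ (u : EuclideanSpace ℝ (Fin d1)) (j : Fin d2),
      (WithLp.equiv ⊤ (Fin d2 → ℝ)) (Mstar u) j
        = ∑ i, M i j * (WithLp.equiv 2 (Fin d1 → ℝ)) u i) :
    pi2 Mstar = sInf {c | ∃ (d : ℕ) (U : Matrix (Fin d1) (Fin d) ℝ)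
      (V : Matrix (Fin d2) (Fin d) ℝ),
      M = U * Vᵀ ∧ c = frobNorm U * norm12 Vᵀ} := by
  have : Nonempty (Fin d2) := ⟨⟨0, hd2⟩⟩
  have hfrob {m n : ℕ} (U : Matrix (Fin m) (Fin n) ℝ) : 0 ≤ frobNorm U := Real.sqrt_nonneg _
  refine le_antisymm ?_ ?_
  · refine le_csInf ⟨_, d2, M, 1, by simp, rfl⟩ ?_
    rintro _ ⟨d, U, V, hM, rfl⟩
    exact csInf_le ⟨0, fun _ h => h.1⟩
      ⟨mul_nonneg (hfrob U) (norm12_nonneg _), summing_of_factorization hMstar hM⟩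
  · refine le_csInf ⟨_, mul_nonneg (hfrob M) (norm12_nonneg (1 : Matrix (Fin d2) (Fin d2) ℝ)ᵀ),
      summing_of_factorization hMstar (by simp)⟩ ?_
    rintro c ⟨hc, h⟩
    obtain ⟨U, V, hM, hle⟩ := exists_factorization_of_summing hMstar hc h
    refine csInf_le_of_le ⟨0, ?_⟩ ⟨d1, U, V, hM, rfl⟩ hle
    rintro _ ⟨d, U, V, -, rfl⟩
    exact mul_nonneg (hfrob U) (norm12_nonneg _)
end

section
/- There exists an absolute constant C such that for all positive integers n, m and every linear map T : ℓ1^n → ℓ∞^m, one has E_{2,1}(T) := Σ_{k≥1} e_k(T)/√k ≤ C √(1 + ln(max(m,n))) · (1 + ln(min(m,n)))^{3/2} · ‖T‖, where ‖T‖ is the operator norm of T : ℓ1^n → ℓ∞^m. -/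
open Real Set Metric
open scoped Pointwise ENNReal

/-- Packing number `M(D,E)`: maximal `l` such that there are `y_1,…,y_l ∈ D`
with `y_i − y_j ∉ E` for all `i ≠ j`. -/
noncomputable def packingNumber {V : Type*} [AddGroup V] (D E : Set V) : ℕ∞ :=
  sSup {l : ℕ∞ | ∃ (l' : ℕ) (y : Fin l' → V), l = (l' : ℕ∞) ∧ (∀ i, y i ∈ D) ∧
    ∀ i j, i ≠ j → y i - y j ∉ E}

/-- Dyadic entropy numbers of a continuous linear map:
`e_k(T) = inf {ε > 0 : M(T(B_X), ε B_Y) ≤ 2^{k−1}}`. -/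
noncomputable def entropyNumber {X Y : Type*} [NormedAddCommGroup X] [NormedSpace ℝ X]
    [NormedAddCommGroup Y] [NormedSpace ℝ Y] (T : X →L[ℝ] Y) (k : ℕ) : ℝ :=
  sInf {ε : ℝ | 0 < ε ∧
    packingNumber (T '' (closedBall (0:X) 1)) (ε • closedBall (0:Y) 1) ≤ (2^(k-1) : ℕ∞)}

/-- `E_{2,1}(T) = Σ_{k ≥ 1} e_k(T)/√k` -/
noncomputable def E21 {X Y : Type*} [NormedAddCommGroup X] [NormedSpace ℝ X]
    [NormedAddCommGroup Y] [NormedSpace ℝ Y] (T : X →L[ℝ] Y) : ℝ :=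
  ∑' k : ℕ, entropyNumber T (k+1) / Real.sqrt (k+1)

/-- An upper bound for entropy numbers: it suffices to label the unit ball with at most `2 ^ k`
labels such that points with equal labels have images at distance at most `ε`. -/
theorem entropyNumber_succ_le_of_label {X Y ι : Type*} [NormedAddCommGroup X] [NormedSpace ℝ X]
    [NormedAddCommGroup Y] [NormedSpace ℝ Y] [Fintype ι] (T : X →L[ℝ] Y) {k : ℕ} {ε : ℝ}
    (hε : 0 < ε) (hι : Fintype.card ι ≤ 2 ^ k) (c : X → ι)
    (hc : ∀ x x', ‖x‖ ≤ 1 → ‖x'‖ ≤ 1 → c x = c x' → ‖T x - T x'‖ ≤ ε) :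
    entropyNumber T (k + 1) ≤ ε := by
  refine csInf_le ⟨0, fun ε h => h.1.le⟩ ⟨hε, sSup_le ?_⟩
  rintro _ ⟨l, y, rfl, hy, hsep⟩
  choose x hx hxy using hy
  have hinj : Function.Injective (c ∘ x) := by
    intro i j hij
    by_contra hne
    apply hsep i j hne
    rw [smul_unitClosedBall_of_nonneg hε.le, mem_closedBall_zero_iff, ← hxy, ← hxy]
    exact hc _ _ (by simpa using hx i) (by simpa using hx j) hij
  have hcard := (Fintype.card_le_of_injective _ hinj).trans hι
  rw [Fintype.card_fin] at hcard
  simpa using (by exact_mod_cast hcard : (l : ℕ∞) ≤ ((2 ^ k : ℕ) : ℕ∞))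

theorem entropyNumber_nonneg {X Y : Type*} [NormedAddCommGroup X] [NormedSpace ℝ X]
    [NormedAddCommGroup Y] [NormedSpace ℝ Y] (T : X →L[ℝ] Y) (k : ℕ) :
    0 ≤ entropyNumber T k :=
  Real.sInf_nonneg fun _ h => h.1.le

/-- The chord bound for `cosh` on a symmetric interval around `u`. -/
theorem Real.cosh_mul_add_le {c z : ℝ} (hc : 0 < c) (hz : |z| ≤ c) (s u : ℝ) :
    cosh (s * (u + z)) ≤
      cosh (s * c) * cosh (s * u) + z / c * (sinh (s * c) * sinh (s * u)) := by
  have key : ∀ w : ℝ, exp (w * z) ≤ cosh (w * c) + z / c * sinh (w * c) := by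
    intro w
    obtain ⟨h1, h2⟩ := abs_le.mp hz
    have ha : 0 ≤ (c + z) / (2 * c) := div_nonneg (by linarith) (by linarith)
    have hb : 0 ≤ (c - z) / (2 * c) := div_nonneg (by linarith) (by linarith)
    have h := convexOn_exp.2 (mem_univ (w * c)) (mem_univ (-(w * c))) ha hb
      (by field_simp; ring)
    have e1 : ((c + z) / (2 * c)) • (w * c) + ((c - z) / (2 * c)) • (-(w * c)) = w * z := by
      simp only [smul_eq_mul]; field_simp; ring
    rw [e1] at h
    refine h.trans (le_of_eq ?_)
    rw [cosh_eq, sinh_eq]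
    simp only [smul_eq_mul]; field_simp; ring
  have h1 := mul_le_mul_of_nonneg_left (key s) (exp_pos (s * u)).le
  have h2 := mul_le_mul_of_nonneg_left (key (-s)) (exp_pos (-(s * u))).le
  rw [neg_mul s c, cosh_neg, sinh_neg] at h2
  have e1 : exp (s * (u + z)) = exp (s * u) * exp (s * z) := by rw [← exp_add]; ring_nf
  have e2 : exp (-(s * (u + z))) = exp (-(s * u)) * exp (-s * z) := by rw [← exp_add]; ring_nf
  rw [cosh_eq (s * (u + z)), e1, e2, cosh_eq (s * u), sinh_eq (s * u)]
  linarith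

/-- One step of the greedy choice: the potential `∑ cosh` grows at most by the factor
`cosh (s * c)` for a suitable member of a centred family bounded by `c`. -/
theorem exists_sum_cosh_add_le {A κ : Type*} [Fintype A] [Fintype κ] {p : A → ℝ}
    (hp : ∀ a, 0 ≤ p a) (hp1 : ∑ a, p a = 1) {z : A → κ → ℝ} {c : ℝ} (hc : 0 < c)
    (hz : ∀ a i, |z a i| ≤ c) (hmean : ∀ i, ∑ a, p a * z a i = 0) (s : ℝ) (u : κ → ℝ) :
    ∃ a, ∑ i, cosh (s * (u i + z a i)) ≤ cosh (s * c) * ∑ i, cosh (s * u i) := by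
  by_contra! h
  set R := cosh (s * c) * ∑ i, cosh (s * u i) with hR
  have hlt : ∑ a, p a * R < ∑ a, p a * ∑ i, cosh (s * (u i + z a i)) := by
    obtain ⟨a, -, ha⟩ : ∃ a ∈ Finset.univ, 0 < p a :=
      Finset.exists_lt_of_sum_lt (s := Finset.univ) (f := fun _ => (0 : ℝ)) (by simp [hp1])
    exact Finset.sum_lt_sum (fun a _ => mul_le_mul_of_nonneg_left (h a).le (hp a))
      ⟨a, Finset.mem_univ a, mul_lt_mul_of_pos_left (h a) ha⟩
  rw [← Finset.sum_mul, hp1, one_mul] at hlt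
  refine absurd hlt (not_lt.mpr ?_)
  simp only [Finset.mul_sum]
  rw [Finset.sum_comm, hR, Finset.mul_sum]
  refine Finset.sum_le_sum fun i _ => ?_
  calc ∑ a, p a * cosh (s * (u i + z a i))
      ≤ ∑ a, (p a * (cosh (s * c) * cosh (s * u i))
          + (p a * z a i) * (sinh (s * c) * sinh (s * u i) / c)) := by
        refine Finset.sum_le_sum fun a _ => ?_
        refine (mul_le_mul_of_nonneg_left (cosh_mul_add_le hc (hz a i) s (u i)) (hp a)).trans
          (le_of_eq ?_)
        ring
    _ = cosh (s * c) * cosh (s * u i) := by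
        rw [Finset.sum_add_distrib, ← Finset.sum_mul, ← Finset.sum_mul, hp1, hmean]
        ring

theorem exists_sum_cosh_sum_le {A κ : Type*} [Fintype A] [Fintype κ] {p : A → ℝ}
    (hp : ∀ a, 0 ≤ p a) (hp1 : ∑ a, p a = 1) {z : A → κ → ℝ} {c : ℝ} (hc : 0 < c)
    (hz : ∀ a i, |z a i| ≤ c) (hmean : ∀ i, ∑ a, p a * z a i = 0) (s : ℝ) (N : ℕ) :
    ∃ f : Fin N → A,
      ∑ i, cosh (s * ∑ j, z (f j) i) ≤ cosh (s * c) ^ N * Fintype.card κ := by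
  induction N with
  | zero => exact ⟨Fin.elim0, by simp⟩
  | succ N ih =>
    obtain ⟨f, hf⟩ := ih
    obtain ⟨a, ha⟩ := exists_sum_cosh_add_le hp hp1 hc hz hmean s (fun i => ∑ j, z (f j) i)
    refine ⟨Fin.snoc f a, ?_⟩
    simp only [Fin.sum_univ_castSucc, Fin.snoc_castSucc, Fin.snoc_last]
    refine ha.trans ?_
    rw [pow_succ', mul_assoc]
    exact mul_le_mul_of_nonneg_left hf (cosh_pos _).le

/-- Empirical approximation in the sup norm: a centred family bounded by `c` admits `N` members,
with repetition, whose sum has coordinates at most `√(2 N log (2 m)) c`. -/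
theorem exists_abs_sum_le {A κ : Type*} [Fintype A] [Fintype κ] [Nonempty κ] {p : A → ℝ}
    (hp : ∀ a, 0 ≤ p a) (hp1 : ∑ a, p a = 1) {z : A → κ → ℝ} {c : ℝ} (hc : 0 < c)
    (hz : ∀ a i, |z a i| ≤ c) (hmean : ∀ i, ∑ a, p a * z a i = 0) {N : ℕ} (hN : 0 < N) :
    ∃ f : Fin N → A, ∀ i,
      |∑ j, z (f j) i| ≤ c * √(2 * N * Real.log (2 * Fintype.card κ)) := by
  set l := Real.log (2 * Fintype.card κ) with hl
  have hκ : (1 : ℝ) ≤ Fintype.card κ := by exact_mod_cast Fintype.card_pos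
  have hN' : (0 : ℝ) < N := by exact_mod_cast hN
  have hl0 : 0 < l := Real.log_pos (by linarith)
  set q := √(2 * N * l) with hq
  have hq0 : 0 < q := Real.sqrt_pos.mpr (by positivity)
  have hq2 : q ^ 2 = 2 * N * l := Real.sq_sqrt (by positivity)
  set s := q / (N * c) with hs
  have hs0 : 0 < s := by positivity
  obtain ⟨f, hf⟩ := exists_sum_cosh_sum_le hp hp1 hc hz hmean s N
  refine ⟨f, fun i => ?_⟩
  set y := ∑ j, z (f j) i with hy
  have h1 : cosh (s * y) ≤ cosh (s * c) ^ N * Fintype.card κ :=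
    (Finset.single_le_sum (f := fun i => cosh (s * ∑ j, z (f j) i))
      (fun i _ => (cosh_pos _).le) (Finset.mem_univ i)).trans hf
  have h2 : cosh (s * c) ^ N ≤ exp (N * ((s * c) ^ 2 / 2)) := by
    rw [exp_nat_mul]
    exact pow_le_pow_left₀ (cosh_pos _).le (cosh_le_exp_half_sq _) _
  have h3 : exp (s * |y|) ≤ 2 * cosh (s * y) := by
    have e : cosh (s * y) = cosh (s * |y|) := by
      rw [← cosh_abs, abs_mul, abs_of_pos hs0]
    rw [e, cosh_eq]
    linarith [exp_pos (-(s * |y|))]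
  have h4 : exp (s * |y|) ≤ exp (N * ((s * c) ^ 2 / 2) + l) := by
    rw [exp_add, hl, Real.exp_log (by linarith)]
    nlinarith
  have h5 := exp_le_exp.mp h4
  have h6 : (N : ℝ) * ((s * c) ^ 2 / 2) + l = s * (c * q) := by
    rw [hs]
    field_simp
    linarith
  rw [h6] at h5
  exact le_of_mul_le_mul_left h5 hs0

/-- Every point of the unit ball of `ℓ₁ⁿ` is a convex combination of signed unit vectors. -/
theorem exists_weights_signed_single {n : ℕ} (hn : 0 < n) (x : PiLp 1 (fun _ : Fin n => ℝ))
    (hx : ‖x‖ ≤ 1) :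
    ∃ p : Fin n × Bool → ℝ, (∀ a, 0 ≤ p a) ∧ ∑ a, p a = 1 ∧
      ∑ a, p a • PiLp.single 1 a.1 (if a.2 then (1 : ℝ) else -1) = x := by
  have hn' : (0 : ℝ) < n := by exact_mod_cast hn
  have hx1 : ‖x‖ = ∑ i, |x i| := by simpa using PiLp.norm_eq_of_L1 x
  refine ⟨fun a => (|x a.1| + (1 - ‖x‖) / n + (if a.2 then 1 else -1) * x a.1) / 2, ?_, ?_, ?_⟩
  · rintro ⟨i, b⟩
    have h1 : 0 ≤ (1 - ‖x‖) / n := div_nonneg (by linarith) hn'.le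
    have h2 := neg_abs_le (x i)
    have h3 := le_abs_self (x i)
    cases b <;> simp <;> linarith
  · rw [Fintype.sum_prod_type]
    simp only [Fintype.sum_bool]
    calc _ = ∑ i, (|x i| + (1 - ‖x‖) / n) := Finset.sum_congr rfl fun i _ => by simp; ring
      _ = 1 := by
        rw [Finset.sum_add_distrib, ← hx1]
        simp
        field_simp
        ring
  · ext i
    rw [Fintype.sum_prod_type]
    simp only [Fintype.sum_bool, WithLp.ofLp_sum, Finset.sum_apply, PiLp.add_apply,
      PiLp.smul_apply, PiLp.single_apply, smul_eq_mul]
    rw [Finset.sum_eq_single i]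
    · simp; ring
    · intro j _ hj
      simp [hj.symm]
    · simp

theorem PiLp.norm_le_of_forall_abs_le {m : ℕ} {y : PiLp ⊤ (fun _ : Fin m => ℝ)} {r : ℝ}
    (hr : 0 ≤ r) (h : ∀ i, |y i| ≤ r) : ‖y‖ ≤ r := by
  rw [PiLp.norm_eq_ciSup]
  exact Real.iSup_le h hr

/-- Maurey's empirical method for operators from `ℓ₁ⁿ` to `ℓ∞ᵐ`. -/
theorem entropyNumber_succ_le_of_pow_le {n m : ℕ} (hn : 0 < n) (hm : 0 < m)
    (T : PiLp 1 (fun _ : Fin n => ℝ) →L[ℝ] PiLp ⊤ (fun _ : Fin m => ℝ)) {t : ℝ} (ht : 0 < t)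
    (hT : ‖T‖ ≤ t) {N k : ℕ} (hN : 0 < N) (hk : (n * 2) ^ N ≤ 2 ^ k) :
    entropyNumber T (k + 1) ≤ 4 * t * √(2 * Real.log (2 * m) / N) := by
  have : Nonempty (Fin m) := ⟨⟨0, hm⟩⟩
  have hN' : (0 : ℝ) < N := by exact_mod_cast hN
  have hm' : (1 : ℝ) ≤ m := by exact_mod_cast hm
  have hlog : 0 < Real.log (2 * m) := Real.log_pos (by linarith)
  let v : Fin n × Bool → PiLp 1 (fun _ : Fin n => ℝ) :=
    fun a => PiLp.single 1 a.1 (if a.2 then (1 : ℝ) else -1)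
  have hv : ∀ a, ‖v a‖ ≤ 1 := by
    rintro ⟨i, b⟩
    cases b <;> simp [v]
  have hTle : ∀ x, ‖x‖ ≤ 1 → ∀ i, |T x i| ≤ t := fun x hx i =>
    (PiLp.norm_apply_le (T x) i).trans <| (T.le_of_opNorm_le hT x).trans <|
      mul_le_of_le_one_right ht.le hx
  have hchoice : ∀ x : PiLp 1 (fun _ : Fin n => ℝ), ∃ f : Fin N → Fin n × Bool, ‖x‖ ≤ 1 →
      ‖T x - (N : ℝ)⁻¹ • ∑ j, T (v (f j))‖ ≤ 2 * t * √(2 * Real.log (2 * m) / N) := by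
    intro x
    by_cases hx : ‖x‖ ≤ 1
    swap
    · exact ⟨fun _ => (⟨0, hn⟩, true), fun h => absurd h hx⟩
    obtain ⟨p, hp, hp1, hpx⟩ := exists_weights_signed_single hn x hx
    have hmean : ∀ i, ∑ a, p a * (T (v a) i - T x i) = 0 := by
      intro i
      have h1 : T x i = ∑ a, p a * T (v a) i := by
        conv_lhs => rw [← hpx]
        simp [v, map_sum]
      simp only [mul_sub]
      rw [Finset.sum_sub_distrib, ← Finset.sum_mul, hp1, ← h1]
      ring
    obtain ⟨f, hf⟩ := exists_abs_sum_le hp hp1 (z := fun a i => T (v a) i - T x i)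
      (c := 2 * t) (by linarith)
      (fun a i => (abs_sub _ _).trans (by linarith [hTle _ (hv a) i, hTle _ hx i])) hmean hN
    refine ⟨f, fun _ => PiLp.norm_le_of_forall_abs_le (by positivity) fun i => ?_⟩
    have h2 : (T x - (N : ℝ)⁻¹ • ∑ j, T (v (f j))) i
        = -((N : ℝ)⁻¹ * ∑ j, (T (v (f j)) i - T x i)) := by
      rw [Finset.sum_sub_distrib]
      simp
      field_simp
      ring
    rw [h2, abs_neg, abs_mul, abs_of_pos (inv_pos.mpr hN')]
    refine (mul_le_mul_of_nonneg_left (hf i) (inv_pos.mpr hN').le).trans (le_of_eq ?_)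
    rw [Fintype.card_fin]
    have h3 : √(2 * N * Real.log (2 * m)) = N * √(2 * Real.log (2 * m) / N) := by
      rw [Real.sqrt_eq_iff_mul_self_eq (by positivity) (by positivity),
        mul_mul_mul_comm, Real.mul_self_sqrt (by positivity)]
      field_simp
    rw [h3]
    field_simp
  choose c hc using hchoice
  refine entropyNumber_succ_le_of_label T (by positivity) (by simpa using hk) c ?_
  intro x x' hx hx' hxx'
  have h1 := hc x hx
  have h2 := hc x' hx'
  rw [hxx'] at h1
  rw [norm_sub_rev] at h2
  refine (norm_sub_le_norm_sub_add_norm_sub _ _ _).trans ((add_le_add h1 h2).trans (le_of_eq ?_))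
  ring

theorem entropyNumber_succ_le_two_mul {X Y : Type*} [NormedAddCommGroup X] [NormedSpace ℝ X]
    [NormedAddCommGroup Y] [NormedSpace ℝ Y] (T : X →L[ℝ] Y) {t : ℝ} (ht : 0 < t)
    (hT : ‖T‖ ≤ t) (k : ℕ) : entropyNumber T (k + 1) ≤ 2 * t := by
  refine entropyNumber_succ_le_of_label T (ι := Unit) (by linarith)
    (by simpa using Nat.one_le_two_pow) (fun _ => ()) fun x x' hx hx' _ => ?_
  have h : ∀ x, ‖x‖ ≤ 1 → ‖T x‖ ≤ t := fun x hx =>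
    (T.le_of_opNorm_le hT x).trans (mul_le_of_le_one_right ht.le hx)
  exact (norm_sub_le _ _).trans (by linarith [h x hx, h x' hx'])

/-- Entropy numbers of operators from `ℓ₁ⁿ` to `ℓ∞ᵐ` decay like `1 / √k`. -/
theorem entropyNumber_succ_le_sqrt {n m : ℕ} (hn : 0 < n) (hm : 0 < m)
    (T : PiLp 1 (fun _ : Fin n => ℝ) →L[ℝ] PiLp ⊤ (fun _ : Fin m => ℝ)) {t : ℝ} (ht : 0 < t)
    (hT : ‖T‖ ≤ t) (k : ℕ) :
    entropyNumber T (k + 1) ≤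
      12 * t * √((1 + Real.log m) * (1 + Real.log n)) / √(k + 1) := by
  have hn' : (1 : ℝ) ≤ n := by exact_mod_cast hn
  have hm' : (1 : ℝ) ≤ m := by exact_mod_cast hm
  have hln : 0 ≤ Real.log n := Real.log_nonneg hn'
  have hlm : 0 ≤ Real.log m := Real.log_nonneg hm'
  set L := Nat.clog 2 (n * 2) with hL
  have hL1 : 1 ≤ L := Nat.clog_pos (by norm_num) (by omega)
  have hL2 : n * 2 ≤ 2 ^ L := Nat.le_pow_clog (by norm_num) _
  have hLlog : (L : ℝ) ≤ 2 * (1 + Real.log n) := by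
    have h1 : 2 ^ (L - 1) < n * 2 := Nat.pow_pred_clog_lt_self (by norm_num) (by omega)
    have h2 : Real.log ((2 : ℝ) ^ (L - 1)) ≤ Real.log (n * 2) :=
      Real.log_le_log (by positivity) (by exact_mod_cast h1.le)
    rw [Real.log_pow, Real.log_mul (by linarith) (by norm_num), Nat.cast_sub hL1] at h2
    push_cast at h2
    nlinarith [Real.log_two_gt_d9]
  have hk0 : (0 : ℝ) < k + 1 := by positivity
  rw [mul_div_assoc, ← Real.sqrt_div' _ hk0.le]
  set B := (1 + Real.log m) * (1 + Real.log n) with hB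
  have hB1 : 1 + Real.log n ≤ B := by nlinarith
  rcases Nat.eq_zero_or_pos (k / L) with h0 | hpos
  · have hkL : k + 1 ≤ L := by
      rcases Nat.div_eq_zero_iff.mp h0 with h | h <;> omega
    have hkL' : (k : ℝ) + 1 ≤ L := by exact_mod_cast hkL
    refine (entropyNumber_succ_le_two_mul T ht hT k).trans ?_
    have h1 : (1 / 6 : ℝ) ≤ √(B / (k + 1)) := by
      apply Real.le_sqrt_of_sq_le
      rw [le_div_iff₀ hk0]
      linarith
    nlinarith
  · set N := k / L with hN
    have hN' : (0 : ℝ) < N := by exact_mod_cast hpos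
    have hpow : (n * 2) ^ N ≤ 2 ^ k := by
      calc (n * 2) ^ N ≤ (2 ^ L) ^ N := Nat.pow_le_pow_left hL2 N
        _ = 2 ^ (L * N) := (pow_mul _ _ _).symm
        _ ≤ 2 ^ k := Nat.pow_le_pow_right (by norm_num) (Nat.mul_div_le k L)
    refine (entropyNumber_succ_le_of_pow_le hn hm T ht hT hpos hpow).trans ?_
    have hkN : (k : ℝ) + 1 ≤ 2 * L * N := by
      have h1 : k + 1 ≤ L * (N + 1) := Nat.lt_mul_div_succ k hL1
      have h2 : L * 1 ≤ L * N := Nat.mul_le_mul_left L hpos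
      have h3 : k + 1 ≤ 2 * L * N := by nlinarith
      exact_mod_cast h3
    have hlog2 : Real.log (2 * m) ≤ 1 + Real.log m := by
      rw [Real.log_mul (by norm_num) (by linarith)]
      linarith [Real.log_two_lt_d9]
    have h4 : 2 * Real.log (2 * m) / N ≤ 3 ^ 2 * (B / (k + 1)) := by
      rw [← mul_div_assoc, div_le_div_iff₀ hN' hk0]
      have h5 : 2 * Real.log (2 * m) * (k + 1) ≤ 2 * (1 + Real.log m) * (2 * L * N) := by
        gcongr
      have h6 : (1 + Real.log m) * (L : ℝ) ≤ (1 + Real.log m) * (2 * (1 + Real.log n)) := by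
        gcongr
      have h7 := mul_le_mul_of_nonneg_right h6 hN'.le
      have h8 : 0 ≤ B * N := by positivity
      rw [hB] at *
      linarith
    calc 4 * t * √(2 * Real.log (2 * m) / N) ≤ 4 * t * √(3 ^ 2 * (B / (k + 1))) := by gcongr
      _ = 12 * t * √(B / (k + 1)) := by
        rw [Real.sqrt_mul (by positivity), Real.sqrt_sq (by norm_num)]
        ring

theorem abs_sub_le_of_floor_eq {a b q : ℝ} (hq : 0 < q) (ha : |a| ≤ 1) (hb : |b| ≤ 1)
    (h : ⌊q * (a + 1) / 2⌋₊ = ⌊q * (b + 1) / 2⌋₊) : |a - b| ≤ 2 / q := by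
  obtain ⟨ha1, -⟩ := abs_le.mp ha
  obtain ⟨hb1, -⟩ := abs_le.mp hb
  have h1 := Nat.floor_le (a := q * (a + 1) / 2) (by nlinarith)
  have h2 := Nat.lt_floor_add_one (q * (a + 1) / 2)
  have h3 := Nat.floor_le (a := q * (b + 1) / 2) (by nlinarith)
  have h4 := Nat.lt_floor_add_one (q * (b + 1) / 2)
  rw [h] at h1 h2
  rw [abs_le, ← neg_div, div_le_iff₀ hq, le_div_iff₀ hq]
  constructor <;> nlinarith

/-- Entropy numbers of an operator controlled by `r` bounded coordinates decay exponentially. -/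
theorem entropyNumber_succ_le_of_coordinates {X Y : Type*} [NormedAddCommGroup X]
    [NormedSpace ℝ X] [NormedAddCommGroup Y] [NormedSpace ℝ Y] (T : X →L[ℝ] Y) {t : ℝ}
    (ht : 0 < t) (hT : ‖T‖ ≤ t) {r : ℕ} (hr : 0 < r) (φ : X → Fin r → ℝ)
    (hφ : ∀ x, ‖x‖ ≤ 1 → ∀ i, |φ x i| ≤ 1)
    (hTφ : ∀ x x' δ, 0 ≤ δ → (∀ i, |φ x i - φ x' i| ≤ δ) → ‖T x - T x'‖ ≤ t * r * δ) (k : ℕ) :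
    entropyNumber T (k + 1) ≤ 4 * t * r / 2 ^ (k / r) := by
  have hr' : (1 : ℝ) ≤ r := by exact_mod_cast hr
  rcases Nat.eq_zero_or_pos (k / r) with h0 | hpos
  · rw [h0, pow_zero, div_one]
    exact (entropyNumber_succ_le_two_mul T ht hT k).trans (by nlinarith)
  set j := k / r with hj
  have h2j : 2 ≤ 2 ^ j := Nat.le_self_pow hpos.ne' 2
  obtain ⟨q, hq⟩ : ∃ q, 2 ^ j = q + 1 := ⟨2 ^ j - 1, by omega⟩
  have hq1 : 1 ≤ q := by omega
  have hq1' : (1 : ℝ) ≤ q := by exact_mod_cast hq1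
  have hq' : (2 : ℝ) ^ j = q + 1 := by exact_mod_cast hq
  have hq0 : (0 : ℝ) < q := by linarith
  have hmain : entropyNumber T (k + 1) ≤ t * r * (2 / q) := by
    refine entropyNumber_succ_le_of_label T (ι := Fin r → Fin (q + 1)) (by positivity) ?_
      (fun x i => ⟨min ⌊(q : ℝ) * (φ x i + 1) / 2⌋₊ q, by omega⟩) ?_
    · simp only [Fintype.card_pi, Fintype.card_fin, Finset.prod_const, Finset.card_univ]
      rw [← hq, ← pow_mul]
      exact Nat.pow_le_pow_right (by norm_num) (Nat.div_mul_le_self k r)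
    · intro x x' hx hx' hxx'
      refine hTφ x x' _ (by positivity) fun i =>
        abs_sub_le_of_floor_eq hq0 (hφ x hx i) (hφ x' hx' i) ?_
      have hle : ∀ y, ‖y‖ ≤ 1 → ⌊(q : ℝ) * (φ y i + 1) / 2⌋₊ ≤ q := fun y hy => by
        refine Nat.floor_le_of_le ?_
        nlinarith [(abs_le.mp (hφ y hy i)).2]
      have h := congrArg Fin.val (congrFun hxx' i)
      simpa [min_eq_left (hle x hx), min_eq_left (hle x' hx')] using h
  refine hmain.trans ?_
  rw [hq', ← mul_div_assoc, div_le_div_iff₀ hq0 (by linarith)]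
  have h : 0 ≤ t * r := by positivity
  nlinarith

theorem entropyNumber_succ_le_two_pow {n m : ℕ} (hn : 0 < n) (hm : 0 < m)
    (T : PiLp 1 (fun _ : Fin n => ℝ) →L[ℝ] PiLp ⊤ (fun _ : Fin m => ℝ)) {t : ℝ} (ht : 0 < t)
    (hT : ‖T‖ ≤ t) (k : ℕ) :
    entropyNumber T (k + 1) ≤ 4 * t * (min m n : ℕ) / 2 ^ (k / min m n) := by
  rcases le_total m n with h | h
  · rw [min_eq_left h]
    have hm' : (1 : ℝ) ≤ m := by exact_mod_cast hm
    refine entropyNumber_succ_le_of_coordinates T ht hT hm (fun x i => T x i / t) ?_ ?_ k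
    · intro x hx i
      rw [abs_div, abs_of_pos ht, div_le_one ht]
      exact (PiLp.norm_apply_le (T x) i).trans <| (T.le_of_opNorm_le hT x).trans <|
        mul_le_of_le_one_right ht.le hx
    · intro x x' δ hδ hx
      refine PiLp.norm_le_of_forall_abs_le (by positivity) fun i => ?_
      have h1 := hx i
      rw [← sub_div, abs_div, abs_of_pos ht, div_le_iff₀ ht] at h1
      rw [PiLp.sub_apply]
      have h2 : 0 ≤ δ * t := by positivity
      nlinarith
  · rw [min_eq_right h]
    refine entropyNumber_succ_le_of_coordinates T ht hT hn (fun x i => x i) ?_ ?_ k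
    · exact fun x hx i => (PiLp.norm_apply_le x i).trans hx
    · intro x x' δ hδ hx
      rw [← map_sub]
      refine (T.le_of_opNorm_le hT _).trans ?_
      rw [mul_assoc]
      refine mul_le_mul_of_nonneg_left ?_ ht.le
      rw [PiLp.norm_eq_of_L1]
      calc ∑ i, ‖(x - x') i‖ ≤ ∑ _i : Fin n, δ := Finset.sum_le_sum fun i _ => hx i
        _ = n * δ := by simp

/-- A sequence that decays like `1 / k` at the start and is bounded by `r / 2 ^ (k / r)` has
partial sums of order `1 + log r`. -/
theorem sum_range_le_of_le_div_of_le_two_pow {a : ℕ → ℝ} (ha : ∀ k, 0 ≤ a k) {b t : ℝ}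
    (hb : 0 ≤ b) (ht : 0 ≤ t) {r : ℕ} (hr : 0 < r) (h1 : ∀ k : ℕ, a k ≤ b / (k + 1))
    (h2 : ∀ k, a k ≤ t * r / 2 ^ (k / r)) (M : ℕ) :
    ∑ k ∈ Finset.range M, a k ≤ 2 * b * (1 + Real.log r) + 2 * t := by
  have hr' : (1 : ℝ) ≤ r := by exact_mod_cast hr
  have hhead : ∑ k ∈ Finset.range (r * (2 * r)), a k ≤ 2 * b * (1 + Real.log r) := by
    calc ∑ k ∈ Finset.range (r * (2 * r)), a k
        ≤ ∑ k ∈ Finset.range (r * (2 * r)), b * ((k : ℝ) + 1)⁻¹ :=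
          Finset.sum_le_sum fun k _ => h1 k
      _ = b * (harmonic (r * (2 * r)) : ℝ) := by
          rw [← Finset.mul_sum, harmonic]
          push_cast
          rfl
      _ ≤ b * (1 + Real.log ((r * (2 * r) : ℕ) : ℝ)) := by
          gcongr
          exact harmonic_le_one_add_log _
      _ ≤ b * (2 * (1 + Real.log r)) := by
          gcongr
          push_cast
          rw [Real.log_mul (by linarith) (by linarith), Real.log_mul (by norm_num) (by linarith)]
          linarith [Real.log_two_lt_d9]
      _ = 2 * b * (1 + Real.log r) := by ring
  have htail : ∀ N : ℕ, ∑ k ∈ Finset.range (r * (2 * r + N)), a k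
      ≤ 2 * b * (1 + Real.log r) + 2 * t - 2 * t / 2 ^ N := by
    intro N
    induction N with
    | zero => simpa using hhead
    | succ N ih =>
      rw [← add_assoc, mul_add_one, Finset.sum_range_add]
      have hr2 : (r : ℝ) * r ≤ 2 ^ (2 * r) := by
        have h : (r : ℝ) ≤ 2 ^ r := by exact_mod_cast Nat.lt_two_pow_self.le
        rw [two_mul, pow_add]
        gcongr
      have hblock : ∑ i ∈ Finset.range r, a (r * (2 * r + N) + i) ≤ t / 2 ^ N := by
        calc ∑ i ∈ Finset.range r, a (r * (2 * r + N) + i)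
            ≤ ∑ _i ∈ Finset.range r, t * r / 2 ^ (2 * r + N) := by
              refine Finset.sum_le_sum fun i hi => (h2 _).trans (le_of_eq ?_)
              rw [Nat.mul_add_div hr, Nat.div_eq_of_lt (Finset.mem_range.mp hi), add_zero]
          _ = t * (r * r) / 2 ^ (2 * r + N) := by simp; ring
          _ ≤ t * 2 ^ (2 * r) / 2 ^ (2 * r + N) := by gcongr
          _ = t / 2 ^ N := by rw [pow_add]; field_simp
      have e : 2 * t / 2 ^ (N + 1) = 2 * t / 2 ^ N - t / 2 ^ N := by
        rw [pow_succ]; field_simp; ring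
      linarith
  have hsub : Finset.range M ⊆ Finset.range (r * (2 * r + M)) :=
    Finset.range_subset_range.mpr (by nlinarith)
  refine (Finset.sum_le_sum_of_subset_of_nonneg hsub fun k _ _ => ha k).trans
    ((htail M).trans ?_)
  have : 0 ≤ 2 * t / 2 ^ M := by positivity
  linarith

theorem E21_le_of_opNorm_le {n m : ℕ} (hn : 0 < n) (hm : 0 < m)
    (T : PiLp 1 (fun _ : Fin n => ℝ) →L[ℝ] PiLp ⊤ (fun _ : Fin m => ℝ)) {t : ℝ} (ht : 0 < t)
    (hT : ‖T‖ ≤ t) :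
    E21 T ≤ 32 * √((1 + Real.log m) * (1 + Real.log n))
      * (1 + Real.log (min m n : ℕ)) * t := by
  have hlog : ∀ l : ℕ, 0 ≤ Real.log l := Real.log_natCast_nonneg
  set B := √((1 + Real.log m) * (1 + Real.log n)) with hB
  have hB1 : 1 ≤ B := by
    apply Real.le_sqrt_of_sq_le
    nlinarith [hlog m, hlog n, mul_nonneg (hlog m) (hlog n)]
  have hterm : ∀ k : ℕ, 0 ≤ entropyNumber T (k + 1) / √(k + 1) := fun k =>
    div_nonneg (entropyNumber_nonneg T _) (Real.sqrt_nonneg _)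
  refine Real.tsum_le_of_sum_range_le hterm fun M => ?_
  have h1 : ∀ k : ℕ, entropyNumber T (k + 1) / √(k + 1) ≤ 12 * t * B / (k + 1) := by
    intro k
    rw [div_le_iff₀ (by positivity)]
    refine (entropyNumber_succ_le_sqrt hn hm T ht hT k).trans (le_of_eq ?_)
    rw [div_mul_eq_mul_div, div_eq_div_iff (by positivity) (by positivity),
      mul_assoc _ (√((k : ℝ) + 1)), Real.mul_self_sqrt (by positivity)]
  have h2 : ∀ k : ℕ, entropyNumber T (k + 1) / √(k + 1)
      ≤ 4 * t * (min m n : ℕ) / 2 ^ (k / min m n) := fun k =>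
    (div_le_self (entropyNumber_nonneg T _)
      (Real.one_le_sqrt.mpr (by linarith [k.cast_nonneg (α := ℝ)]))).trans
      (entropyNumber_succ_le_two_pow hn hm T ht hT k)
  have h := sum_range_le_of_le_div_of_le_two_pow hterm (by positivity) (by positivity)
    (lt_min hm hn) h1 h2 M
  refine h.trans ?_
  have h3 : 1 ≤ B * (1 + Real.log (min m n : ℕ)) := by nlinarith [hlog (min m n)]
  nlinarith

theorem stmt_10 :
    ∃ C : ℝ, 0 < C ∧
    ∀ (n m : ℕ), 0 < n → 0 < m →
    ∀ T : PiLp 1 (fun _ : Fin n => ℝ) →L[ℝ] PiLp ⊤ (fun _ : Fin m => ℝ),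
      E21 T ≤ C * Real.sqrt (1 + Real.log (max m n))
        * (1 + Real.log (min m n)) ^ ((3:ℝ)/2) * ‖T‖ := by
  refine ⟨32, by norm_num, fun n m hn hm T => ?_⟩
  have hlog : ∀ l : ℕ, 0 ≤ Real.log l := Real.log_natCast_nonneg
  rw [← Nat.cast_max, ← Nat.cast_min]
  have hpow : (1 + Real.log (min m n : ℕ)) ^ ((3 : ℝ) / 2)
      = √(1 + Real.log (min m n : ℕ)) * (1 + Real.log (min m n : ℕ)) := by
    have h : 0 < 1 + Real.log (min m n : ℕ) := by linarith [hlog (min m n)]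
    rw [Real.sqrt_eq_rpow, ← Real.rpow_add_one h.ne']
    norm_num
  have hprod : √((1 + Real.log m) * (1 + Real.log n))
      = √(1 + Real.log (max m n : ℕ)) * √(1 + Real.log (min m n : ℕ)) := by
    rw [← Real.sqrt_mul (by linarith [hlog (max m n)])]
    rcases le_total m n with h | h
    · rw [max_eq_right h, min_eq_left h, mul_comm]
    · rw [max_eq_left h, min_eq_right h]
  set K := 32 * √(1 + Real.log (max m n : ℕ))
    * (1 + Real.log (min m n : ℕ)) ^ ((3 : ℝ) / 2) with hK
  have hbound : ∀ t, ‖T‖ < t → E21 T ≤ K * t := fun t ht => by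
    refine (E21_le_of_opNorm_le hn hm T ((norm_nonneg T).trans_lt ht) ht.le).trans (le_of_eq ?_)
    rw [hK, hpow, hprod]
    ring
  have hcont : Filter.Tendsto (fun t => K * t) (nhdsWithin ‖T‖ (Ioi ‖T‖)) (nhds (K * ‖T‖)) :=
    ((continuous_const.mul continuous_id).tendsto _).mono_left nhdsWithin_le_nhds
  exact ge_of_tendsto hcont (eventually_nhdsWithin_of_forall hbound)
end
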